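/- For every real $\epsilon$ with $0 < \epsilon < 1/2$ there exists a constant $C = C(\epsilon) > 0$ such that for every prime $p$ with $p \equiv 1 \pmod{12}$ or $p \equiv 11 \pmod{12}$ one has $\frac{p-1}{6} - N(p, S_3) \ge C\, p^{\frac{1}{2} - \epsilon}$ (as real numbers). -/

import Mathlib

/-- `a` is a quadratic residue modulo `p`: the congruence `x^2 ≡ a (mod p)` has a solution in `ℤ`. -/
def IsQR (p a : ℕ) : Prop := ∃ x : ℤ, x ^ 2 ≡ (a : ℤ) [ZMOD (p : ℤ)]

open Classical in
/-- `Q(p, S_k)`: the number of quadratic residues modulo `p` in `[1, p-1]` that are multiples of `k`. -/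
noncomputable def Qcount (p k : ℕ) : ℕ :=
  ((Finset.Icc 1 (p - 1)).filter fun a => k ∣ a ∧ IsQR p a).card

open Classical in
/-- `N(p, S_k)`: the number of quadratic non-residues modulo `p` in `[1, p-1]` that are multiples of `k`. -/
noncomputable def Ncount (p k : ℕ) : ℕ :=
  ((Finset.Icc 1 (p - 1)).filter fun a => k ∣ a ∧ ¬ IsQR p a).card

open Classical in
/-- `Q(p, 𝒪)`: the number of quadratic residues modulo `p` among the odd integers in `[1, p-1]`. -/
noncomputable def QcountOdd (p : ℕ) : ℕ :=
  ((Finset.Icc 1 (p - 1)).filter fun a => Odd a ∧ IsQR p a).card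

open Classical in
/-- `Q(p, S_2 \ S_4)`: the number of quadratic residues modulo `p` in `[1, p-1]`
divisible by `2` but not by `4`. -/
noncomputable def Qcount2not4 (p : ℕ) : ℕ :=
  ((Finset.Icc 1 (p - 1)).filter fun a => (2 ∣ a ∧ ¬ (4 ∣ a)) ∧ IsQR p a).card

section

open Finset Filter Topology MeasureTheory Complex

namespace DirichletCharacter

variable {N : ℕ}

/-- The partial sums of a Dirichlet character, as a function of a real variable. -/
noncomputable def partialSum (χ : DirichletCharacter ℂ N) (t : ℝ) : ℂ :=
  ∑ k ∈ Icc 1 ⌊t⌋₊, χ (k : ZMod N)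

lemma norm_partialSum_le_self (χ : DirichletCharacter ℂ N) {t : ℝ} (ht : 0 ≤ t) :
    ‖partialSum χ t‖ ≤ t := by
  refine (norm_sum_le _ _).trans ((sum_le_sum fun _ _ => χ.norm_le_one _).trans ?_)
  simpa using Nat.floor_le ht

lemma measurable_partialSum (χ : DirichletCharacter ℂ N) : Measurable (partialSum χ) :=
  (measurable_from_nat (f := fun n : ℕ => ∑ k ∈ Icc 1 n, χ (k : ZMod N))).comp
    Nat.measurable_floor

variable [NeZero N]

lemma sum_range_level_eq_zero {χ : DirichletCharacter ℂ N} (hχ : χ ≠ 1) :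
    ∑ k ∈ range N, χ (k : ZMod N) = 0 := by
  rw [← MulChar.sum_eq_zero_of_ne_one hχ]
  refine Finset.sum_bij (fun k _ => (k : ZMod N)) (by simp) ?_ ?_ (by simp)
  · intro a ha b hb h
    rw [ZMod.natCast_eq_natCast_iff'] at h
    rwa [Nat.mod_eq_of_lt (mem_range.1 ha), Nat.mod_eq_of_lt (mem_range.1 hb)] at h
  · intro b _
    exact ⟨b.val, mem_range.2 b.val_lt, by simp⟩

lemma norm_sum_range_le {χ : DirichletCharacter ℂ N} (hχ : χ ≠ 1) (n : ℕ) :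
    ‖∑ k ∈ range n, χ (k : ZMod N)‖ ≤ N := by
  have key (q r : ℕ) : ∑ k ∈ range (N * q + r), χ (k : ZMod N) = ∑ k ∈ range r, χ (k : ZMod N) := by
    induction q with
    | zero => simp
    | succ q ih =>
      rw [show N * (q + 1) + r = N + (N * q + r) by ring, Finset.sum_range_add,
        sum_range_level_eq_zero hχ, zero_add, ← ih]
      simp
  rw [← Nat.div_add_mod n N, key]
  refine (norm_sum_le _ _).trans ?_
  refine (sum_le_sum fun _ _ => χ.norm_le_one _).trans ?_
  simpa using (Nat.mod_lt n (NeZero.pos N)).le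

lemma norm_partialSum_le_level {χ : DirichletCharacter ℂ N} (hχ : χ ≠ 1) (t : ℝ) :
    ‖partialSum χ t‖ ≤ 2 * N := by
  have h : partialSum χ t = ∑ k ∈ range (⌊t⌋₊ + 1), χ (k : ZMod N) - χ (0 : ZMod N) := by
    rw [partialSum, sum_range_succ', Nat.cast_zero, add_sub_cancel_right,
      range_eq_Ico, sum_Ico_add' (fun k : ℕ => χ (k : ZMod N)) 0 ⌊t⌋₊ 1]
    rfl
  rw [h]
  refine (norm_sub_le _ _).trans ?_
  have h1 := norm_sum_range_le hχ (⌊t⌋₊ + 1)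
  have h2 := χ.norm_le_one 0
  have h3 : (1 : ℝ) ≤ N := by exact_mod_cast NeZero.pos N
  linarith

lemma norm_partialSum_mul_cpow_le {χ : DirichletCharacter ℂ N} (hχ : χ ≠ 1) (s : ℂ) {t : ℝ}
    (ht : t ∈ Set.Ioi (1 : ℝ)) :
    ‖partialSum χ t * (t : ℂ) ^ (-(s + 1))‖ ≤ 2 * N * t ^ (-s.re - 1) := by
  have ht0 : 0 < t := zero_lt_one.trans ht
  rw [norm_mul, norm_cpow_eq_rpow_re_of_pos ht0]
  rw [show (-(s + 1)).re = -s.re - 1 by simp; ring]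
  gcongr
  exact norm_partialSum_le_level hχ t

lemma LFunction_eq_mul_integral {χ : DirichletCharacter ℂ N} (hχ : χ ≠ 1) {s : ℂ}
    (hs : 0 < s.re) :
    LFunction χ s = s * ∫ t in Set.Ioi (1 : ℝ), partialSum χ t * (t : ℂ) ^ (-(s + 1)) := by
  have hmel (s : ℂ) : ∫ t in Set.Ioi (1 : ℝ), partialSum χ t * (t : ℂ) ^ (-(s + 1)) =
      mellin (partialSum χ) (-s) := by
    rw [mellin, ← integral_Ici_eq_integral_Ioi (x := (1 : ℝ)),
      setIntegral_eq_of_subset_of_forall_sdiff_eq_zero (s := Set.Ici (1 : ℝ))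
        (t := Set.Ioi (0 : ℝ)) measurableSet_Ioi]
    · refine setIntegral_congr_fun measurableSet_Ici fun t _ => ?_
      simp only [smul_eq_mul]
      rw [mul_comm, neg_add']
    · exact fun t ht => zero_lt_one.trans_le (Set.mem_Ici.1 ht)
    · rintro t ⟨ht, ht'⟩
      have ht1 : t < 1 := lt_of_not_ge ht'
      simp [partialSum, Nat.floor_eq_zero.2 ht1]
  have hdiff : DifferentiableOn ℂ (fun s : ℂ => s * mellin (partialSum χ) (-s)) {s | 0 < s.re} := by
    intro s hs
    refine DifferentiableAt.differentiableWithinAt (differentiableAt_id.mul ?_)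
    refine DifferentiableAt.comp (g := mellin (partialSum χ)) (f := fun s : ℂ => -s) s ?_
      differentiableAt_id.neg
    refine mellin_differentiableAt_of_isBigO_rpow (a := 0) (b := -s.re - 1) ?_ ?_ ?_ ?_ ?_
    · refine (locallyIntegrable_const (2 * N : ℝ)).locallyIntegrableOn _ |>.mono
        (measurable_partialSum χ).aestronglyMeasurable (Eventually.of_forall fun t => ?_)
      exact (norm_partialSum_le_level hχ t).trans (Real.le_norm_self _)
    · refine Asymptotics.IsBigO.of_bound (2 * N) (Eventually.of_forall fun t => ?_)
      simpa using norm_partialSum_le_level hχ t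
    · simpa using hs
    · refine Asymptotics.IsBigO.of_bound 0 ?_
      filter_upwards [Ioo_mem_nhdsGT (zero_lt_one' ℝ)] with t ht
      simp [partialSum, Nat.floor_eq_zero.2 ht.2]
    · simp
  rw [hmel]
  have hopen : IsOpen {s : ℂ | 0 < s.re} := isOpen_lt continuous_const continuous_re
  refine AnalyticOnNhd.eqOn_of_preconnected_of_eventuallyEq
    (f := LFunction χ) (g := fun s : ℂ => s * mellin (partialSum χ) (-s)) (z₀ := 2)
    ((differentiable_LFunction hχ).differentiableOn.analyticOnNhd hopen)
    (hdiff.analyticOnNhd hopen)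
    (convex_halfSpace_re_gt 0).isPreconnected (by simp) ?_ hs
  filter_upwards [(isOpen_lt continuous_const continuous_re).mem_nhds
    (show (1 : ℝ) < (2 : ℂ).re by simp)] with s hs
  have hs1 : 1 < s.re := hs
  rw [LFunction_eq_LSeries χ hs1, ← hmel, LSeries_eq_mul_integral (fun n => χ (n : ZMod N)) le_rfl
    (zero_lt_one.trans hs1) (LSeriesSummable_of_one_lt_re χ hs1)]
  · rfl
  · refine Asymptotics.IsBigO.of_bound (2 * N) (Eventually.of_forall fun n => ?_)
    simpa [partialSum] using norm_partialSum_le_level hχ n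

lemma norm_LFunction_le {χ : DirichletCharacter ℂ N} (hχ : χ ≠ 1) {s : ℂ} (hs : 0 < s.re) :
    ‖LFunction χ s‖ ≤ 2 * N * ‖s‖ / s.re := by
  rw [LFunction_eq_mul_integral hχ hs, norm_mul]
  have h1 : ‖∫ t in Set.Ioi (1 : ℝ), partialSum χ t * (t : ℂ) ^ (-(s + 1))‖ ≤
      ∫ t in Set.Ioi (1 : ℝ), 2 * N * t ^ (-s.re - 1) := by
    refine norm_integral_le_of_norm_le ?_ ?_
    · exact (integrableOn_Ioi_rpow_of_lt (by linarith) one_pos).const_mul _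
    · filter_upwards [ae_restrict_mem measurableSet_Ioi] with t ht
      exact norm_partialSum_mul_cpow_le hχ s ht
  rw [integral_const_mul, integral_Ioi_rpow_of_lt (by linarith) one_pos] at h1
  refine (mul_le_mul_of_nonneg_left h1 (norm_nonneg s)).trans_eq ?_
  simp
  field_simp

lemma norm_LFunction_one_le {χ : DirichletCharacter ℂ N} (hχ : χ ≠ 1) {η : ℝ} (hη : 0 < η)
    (hη1 : η ≤ 1) :
    ‖LFunction χ 1‖ ≤ (2 * N) ^ η / η := by
  rw [LFunction_eq_mul_integral hχ (by simp), one_mul]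
  have h1 : ‖∫ t in Set.Ioi (1 : ℝ), partialSum χ t * (t : ℂ) ^ (-((1 : ℂ) + 1))‖ ≤
      ∫ t in Set.Ioi (1 : ℝ), (2 * N) ^ η * t ^ (-η - 1) := by
    refine norm_integral_le_of_norm_le ?_ ?_
    · exact (integrableOn_Ioi_rpow_of_lt (by linarith) one_pos).const_mul _
    · filter_upwards [ae_restrict_mem measurableSet_Ioi] with t ht
      have ht0 : 0 < t := zero_lt_one.trans ht
      rw [norm_mul, norm_cpow_eq_rpow_re_of_pos ht0]
      have h2 : ‖partialSum χ t‖ ≤ (2 * N) ^ η * t ^ (1 - η) := by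
        calc ‖partialSum χ t‖ = ‖partialSum χ t‖ ^ η * ‖partialSum χ t‖ ^ (1 - η) := by
              rw [← Real.rpow_add_of_nonneg (norm_nonneg _) hη.le (by linarith)]
              simp
          _ ≤ _ := by
              have := norm_partialSum_le_level hχ t
              have := norm_partialSum_le_self χ ht0.le
              gcongr
      calc _ ≤ (2 * N) ^ η * t ^ (1 - η) * t ^ (-((1 : ℂ) + 1)).re := by gcongr
        _ = _ := by
          rw [mul_assoc, ← Real.rpow_add ht0]
          congr 2
          simp
          ring
  rw [integral_const_mul, integral_Ioi_rpow_of_lt (by linarith) one_pos] at h1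
  refine h1.trans_eq ?_
  simp
  field_simp

end DirichletCharacter

end

section

open Finset Filter Topology MeasureTheory Complex
open scoped ComplexOrder Nat

lemma ArithmeticFunction.mk_mul_prime_pow {R : Type*} [CommSemiring R] (f g : ArithmeticFunction R)
    {p : ℕ}
    (hp : p.Prime) :
    PowerSeries.mk (fun k => (f * g) (p ^ k)) =
      PowerSeries.mk (fun k => f (p ^ k)) * PowerSeries.mk (fun k => g (p ^ k)) := by
  ext k
  simp [PowerSeries.coeff_mul, ArithmeticFunction.mul_apply,
    Nat.sum_divisorsAntidiagonal (fun i j => f i * g j),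
    Nat.divisors_prime_pow hp, Finset.Nat.sum_antidiagonal_eq_sum_range_succ
      (fun i j => f (p ^ i) * g (p ^ j))]
  refine sum_congr rfl fun i hi => ?_
  rw [Nat.pow_div (by simpa [Nat.lt_succ_iff] using hi) hp.pos]

lemma PowerSeries.coeff_mul_nonneg {A B : PowerSeries ℂ} (hA : ∀ k, 0 ≤ coeff k A)
    (hB : ∀ k, 0 ≤ coeff k B) (k : ℕ) : 0 ≤ coeff k (A * B) := by
  rw [coeff_mul]
  exact sum_nonneg fun _ _ => mul_nonneg (hA _) (hB _)

lemma PowerSeries.coeff_mk_one_mul_mk_pow_nonneg {x : ℂ} (hx : x = 0 ∨ x = 1 ∨ x = -1) (k : ℕ) :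
    0 ≤ coeff k (mk (fun k => (1 : ℂ) ^ k) * mk (fun k => x ^ k)) := by
  rw [mul_comm, coeff_mul, Finset.Nat.sum_antidiagonal_eq_sum_range_succ_mk]
  simp only [coeff_mk, one_pow, mul_one]
  rcases hx with rfl | rfl | rfl
  · exact sum_nonneg fun i _ => pow_nonneg le_rfl i
  · exact sum_nonneg fun i _ => pow_nonneg zero_le_one i
  · rw [neg_one_geom_sum]
    split_ifs <;> simp

namespace DirichletCharacter

variable {q₁ q₂ q₃ : ℕ}

/-- A Dirichlet character as an arithmetic function. -/
noncomputable abbrev arith {q : ℕ} (χ : DirichletCharacter ℂ q) : ArithmeticFunction ℂ :=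
  toArithmeticFunction (fun n => χ (n : ZMod q))

lemma arith_prime_pow {q : ℕ} (χ : DirichletCharacter ℂ q) {p : ℕ} (hp : p.Prime) (k : ℕ) :
    arith χ (p ^ k) = χ (p : ZMod q) ^ k := by
  simp [arith, toArithmeticFunction, hp.ne_zero]

/-- The coefficients of the product of the Riemann zeta function and three Dirichlet L-functions. -/
noncomputable def quadMul (χ : DirichletCharacter ℂ q₁) (ψ : DirichletCharacter ℂ q₂)
    (θ : DirichletCharacter ℂ q₃) : ArithmeticFunction ℂ :=
  zetaMul χ * (arith ψ * arith θ)

variable {χ : DirichletCharacter ℂ q₁} {ψ : DirichletCharacter ℂ q₂} {θ : DirichletCharacter ℂ q₃}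

lemma quadMul_prime_pow_nonneg (hχ : χ ^ 2 = 1) (hψ : ψ ^ 2 = 1)
    (hθ : ∀ n : ℕ, θ n = χ n * ψ n) {p : ℕ} (hp : p.Prime) (k : ℕ) :
    0 ≤ quadMul χ ψ θ (p ^ k) := by
  have h : quadMul χ ψ θ (p ^ k) = PowerSeries.coeff k
      (PowerSeries.mk (fun k => quadMul χ ψ θ (p ^ k))) := by simp
  rw [h, quadMul, ArithmeticFunction.mk_mul_prime_pow _ _ hp,
    ArithmeticFunction.mk_mul_prime_pow _ _ hp,
    zetaMul, ArithmeticFunction.mk_mul_prime_pow _ _ hp]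
  have hz : PowerSeries.mk (fun k => (ArithmeticFunction.zeta : ArithmeticFunction ℂ) (p ^ k)) =
      PowerSeries.mk (fun k => (1 : ℂ) ^ k) := by
    ext k
    simp [ArithmeticFunction.natCoe_apply, ArithmeticFunction.zeta_apply, hp.ne_zero]
  simp only [arith_prime_pow _ hp, hz, hθ]
  set G : ℂ → PowerSeries ℂ := fun x => PowerSeries.mk (fun k => x ^ k) with hG
  have key : ∀ x : ℂ, (x = 0 ∨ x = 1 ∨ x = -1) → ∀ k, 0 ≤ PowerSeries.coeff k (G 1 * G x) :=
    fun x hx k => PowerSeries.coeff_mk_one_mul_mk_pow_nonneg hx k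
  have key0 : ∀ k, 0 ≤ PowerSeries.coeff k (G 0) := fun k => by
    simp [hG]
  have hy := MulChar.isQuadratic_iff_sq_eq_one.mpr hψ p
  change 0 ≤ PowerSeries.coeff k (G 1 * G (χ p) * (G (ψ p) * G (χ p * ψ p)))
  rcases MulChar.isQuadratic_iff_sq_eq_one.mpr hχ p with h | h | h
  · rw [h, zero_mul, show G 1 * G 0 * (G (ψ p) * G 0) = G 1 * G (ψ p) * (G 0 * G 0) by ring]
    exact PowerSeries.coeff_mul_nonneg (key _ hy) (PowerSeries.coeff_mul_nonneg key0 key0) k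
  · rw [h, one_mul, show G 1 * G 1 * (G (ψ p) * G (ψ p)) = G 1 * G (ψ p) * (G 1 * G (ψ p)) by ring]
    exact PowerSeries.coeff_mul_nonneg (key _ hy) (key _ hy) k
  · rcases hy with h' | h' | h' <;> rw [h, h']
    · rw [mul_zero]
      exact PowerSeries.coeff_mul_nonneg (key _ (by simp))
        (PowerSeries.coeff_mul_nonneg key0 key0) k
    · rw [mul_one]
      exact PowerSeries.coeff_mul_nonneg (key _ (by simp)) (key _ (by simp)) k
    · rw [neg_mul_neg, one_mul, mul_comm (G (-1)) (G 1)]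
      exact PowerSeries.coeff_mul_nonneg (key _ (by simp)) (key _ (by simp)) k

lemma isMultiplicative_quadMul (χ : DirichletCharacter ℂ q₁) (ψ : DirichletCharacter ℂ q₂)
    (θ : DirichletCharacter ℂ q₃) : (quadMul χ ψ θ).IsMultiplicative :=
  (isMultiplicative_zetaMul χ).mul
    ((isMultiplicative_toArithmeticFunction ψ).mul (isMultiplicative_toArithmeticFunction θ))

lemma quadMul_nonneg (hχ : χ ^ 2 = 1) (hψ : ψ ^ 2 = 1)
    (hθ : ∀ n : ℕ, θ n = χ n * ψ n) (n : ℕ) : 0 ≤ quadMul χ ψ θ n := by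
  rcases eq_or_ne n 0 with rfl | hn
  · simp
  · rw [(isMultiplicative_quadMul χ ψ θ).multiplicative_factorization _ hn]
    exact Finset.prod_nonneg fun p hp =>
      quadMul_prime_pow_nonneg hχ hψ hθ (Nat.prime_of_mem_primeFactors hp) _

lemma LSeriesSummable_arith {q : ℕ} (χ : DirichletCharacter ℂ q) {s : ℂ} (hs : 1 < s.re) :
    LSeriesSummable (arith χ) s :=
  (LSeriesSummable_congr s fun {n} hn => by simp [toArithmeticFunction, hn]).1
    (LSeriesSummable_of_one_lt_re χ hs)

lemma LSeries_arith {q : ℕ} [NeZero q] (χ : DirichletCharacter ℂ q) {s : ℂ} (hs : 1 < s.re) :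
    LSeries (arith χ) s = LFunction χ s := by
  rw [LFunction_eq_LSeries χ hs]
  exact LSeries_congr (fun {n} hn => by simp [toArithmeticFunction, hn]) s

lemma LSeriesSummable_quadMul (χ : DirichletCharacter ℂ q₁) (ψ : DirichletCharacter ℂ q₂)
    (θ : DirichletCharacter ℂ q₃) {s : ℂ} (hs : 1 < s.re) : LSeriesSummable (quadMul χ ψ θ) s :=
  ArithmeticFunction.LSeriesSummable_mul (LSeriesSummable_zetaMul χ hs)
    (ArithmeticFunction.LSeriesSummable_mul (LSeriesSummable_arith ψ hs)
      (LSeriesSummable_arith θ hs))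

lemma LSeries_quadMul [NeZero q₁] [NeZero q₂] [NeZero q₃] (χ : DirichletCharacter ℂ q₁)
    (ψ : DirichletCharacter ℂ q₂) (θ : DirichletCharacter ℂ q₃) {s : ℂ} (hs : 1 < s.re) :
    LSeries (quadMul χ ψ θ) s =
      riemannZeta s * (LFunction χ s * LFunction ψ s * LFunction θ s) := by
  rw [quadMul, ArithmeticFunction.LSeries_mul' (LSeriesSummable_zetaMul χ hs)
    (ArithmeticFunction.LSeriesSummable_mul (LSeriesSummable_arith ψ hs)
      (LSeriesSummable_arith θ hs)),
    ArithmeticFunction.LSeries_mul' (LSeriesSummable_arith ψ hs) (LSeriesSummable_arith θ hs),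
    zetaMul]
  have h := ArithmeticFunction.LSeries_mul' (s := s)
    (f := (ArithmeticFunction.zeta : ArithmeticFunction ℂ)) (g := arith χ)
    (by simpa [ArithmeticFunction.natCoe_apply] using
      ArithmeticFunction.LSeriesSummable_zeta_iff.mpr hs) (LSeriesSummable_arith χ hs)
  have hz := ArithmeticFunction.LSeries_zeta_eq_riemannZeta hs
  rw [h]
  simp only [LSeries_arith _ hs]
  rw [← hz]
  simp only [ArithmeticFunction.natCoe_apply]
  ring

lemma quadMul_one (χ : DirichletCharacter ℂ q₁) (ψ : DirichletCharacter ℂ q₂)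
    (θ : DirichletCharacter ℂ q₃) : quadMul χ ψ θ 1 = 1 :=
  (isMultiplicative_quadMul χ ψ θ).1

end DirichletCharacter

end

section

open Finset Filter Topology MeasureTheory Complex
open scoped ComplexOrder Nat

lemma LSeries.one_le_re_of_nonneg {a : ℕ → ℂ} (ha : 0 ≤ a) (ha1 : a 1 = 1) {s : ℂ}
    (hs : LSeriesSummable a s) (hs' : s.im = 0) : 1 ≤ (LSeries a s).re := by
  have h0 : ∀ n, 0 ≤ term a s n := fun n => by
    obtain ⟨x, rfl⟩ : ∃ x : ℝ, s = x := ⟨s.re, by apply Complex.ext <;> simp [hs']⟩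
    exact term_nonneg (ha n) x
  have h := hs.hasSum.mapL reCLM
  rw [LSeries]
  have := h.summable.le_tsum 1 (fun n _ => (Complex.nonneg_iff.1 (h0 n)).1)
  have h2 := h.tsum_eq
  simp only [reCLM_apply] at this h2
  rw [h2] at this
  simpa [term, ha1] using this

/-- Estermann's inequality: a Dirichlet series with nonnegative coefficients and a simple pole at
`1` cannot be too small slightly to the left of `1`. -/
lemma LSeries.estermann_le {a : ℕ → ℂ} (ha : 0 ≤ a) (ha1 : a 1 = 1)
    (hsum : ∀ s : ℂ, 1 < s.re → LSeriesSummable a s) {H : ℂ → ℂ} (hH : Differentiable ℂ H)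
    {l M : ℝ} (hHa : ∀ s : ℂ, 1 < s.re → H s = LSeries a s - l * (s - 1)⁻¹)
    (hM : ∀ s ∈ Metric.sphere (2 : ℂ) (3 / 2), ‖H s‖ ≤ M) {δ : ℝ} (hδ : 0 < δ) (hδ' : δ ≤ 1 / 8)
    {n : ℕ} (hn : n ≠ 0) :
    1 - l * (1 + δ) ^ n / δ - 4 * M * (3 / 4) ^ n ≤ (H (1 - δ : ℝ)).re - l / δ := by
  have hab : abscissaOfAbsConv a < (2 : ℝ) := by
    refine lt_of_le_of_lt (b := ((1 : ℝ) : EReal))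
      (abscissaOfAbsConv_le_of_forall_lt_LSeriesSummable fun y hy => hsum _ (by simpa using hy)) ?_
    exact_mod_cast one_lt_two
  have hopen : {s : ℂ | 1 < s.re} ∈ 𝓝 (2 : ℂ) :=
    (isOpen_lt continuous_const continuous_re).mem_nhds (by simp)
  have hM0 : 0 ≤ M := (norm_nonneg _).trans (hM (2 + (3 / 2 : ℝ)) (by simp))
  have hinv (k : ℕ) : iteratedDeriv k (fun s : ℂ => (s - 1)⁻¹) 2 = (-1) ^ k * k ! := by
    rw [iteratedDeriv_comp_sub_const k (fun s : ℂ => s⁻¹) 1, iteratedDeriv_eq_iterate]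
    change (deriv^[k] Inv.inv) ((2 : ℂ) - 1) = _
    rw [iter_deriv_inv]
    norm_num
  have hder (k : ℕ) : iteratedDeriv k H 2 =
      iteratedDeriv k (LSeries a) 2 - l * ((-1) ^ k * k !) := by
    have h1 : H =ᶠ[𝓝 2] fun s => LSeries a s - l * (s - 1)⁻¹ := by
      filter_upwards [hopen] with s hs using hHa s hs
    have h2 : AnalyticAt ℂ (LSeries a) 2 := LSeries_analyticOnNhd a 2 (by simpa using hab)
    have h3 : AnalyticAt ℂ (fun s : ℂ => (s - 1)⁻¹) 2 :=
      (analyticAt_id.sub analyticAt_const).inv (by norm_num)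
    rw [h1.iteratedDeriv_eq, iteratedDeriv_fun_sub h2.contDiffAt
      (show AnalyticAt ℂ (fun s : ℂ => (l : ℂ) * (s - 1)⁻¹) 2 from
        analyticAt_const.mul h3).contDiffAt, iteratedDeriv_const_mul_field, hinv]
  set b : ℕ → ℝ := fun k => ((-1) ^ k * iteratedDeriv k (LSeries a) 2).re / k ! with hb
  have hb0 (k : ℕ) : 0 ≤ b k :=
    div_nonneg (Complex.nonneg_iff.1 (iteratedDeriv_alternating ha hab k)).1 (by positivity)
  have hb1 : 1 ≤ b 0 := by
    simpa [hb] using one_le_re_of_nonneg ha ha1 (hsum 2 (by simp)) (by simp)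
  have htay := (Complex.hasSum_taylorSeries_of_entire hH 2 (1 - δ : ℝ)).mapL reCLM
  have hterm (k : ℕ) : reCLM ((k ! : ℂ)⁻¹ • (((1 - δ : ℝ) : ℂ) - 2) ^ k • iteratedDeriv k H 2) =
      (b k - l) * (1 + δ) ^ k := by
    have e1 : (((1 - δ : ℝ) : ℂ) - 2) ^ k = (((1 + δ) ^ k : ℝ) : ℂ) * (-1) ^ k := by
      rw [ofReal_pow, ← mul_pow]; congr 1; push_cast; ring
    have e2 : ((-1 : ℂ) ^ k) * (-1) ^ k = 1 := by rw [← mul_pow]; simp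
    have e3 : (k ! : ℂ)⁻¹ • (((1 - δ : ℝ) : ℂ) - 2) ^ k • iteratedDeriv k H 2 =
      (((1 + δ) ^ k / k ! : ℝ) : ℂ) * ((-1) ^ k * iteratedDeriv k (LSeries a) 2) -
        ((l * (1 + δ) ^ k : ℝ) : ℂ) := by
      rw [hder, e1, smul_eq_mul, smul_eq_mul]
      have : (k ! : ℂ) ≠ 0 := by exact_mod_cast k.factorial_ne_zero
      push_cast
      field_simp
      linear_combination (-l * k ! : ℂ) * e2
    rw [e3, reCLM_apply, sub_re, re_ofReal_mul, ofReal_re, hb]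
    ring
  simp only [hterm, reCLM_apply] at htay
  have hbound (k : ℕ) : |(b k - l) * (1 + δ) ^ k| ≤ M * (3 / 4) ^ k := by
    have h1 := norm_iteratedDeriv_le_of_forall_mem_sphere_norm_le k
      (show (0 : ℝ) < 3 / 2 by norm_num) hH.diffContOnCl hM
    rw [← hterm, reCLM_apply]
    refine (abs_re_le_norm _).trans ?_
    rw [norm_smul, norm_smul, norm_pow, norm_inv, Complex.norm_natCast]
    have h2 : ‖((1 - δ : ℝ) : ℂ) - 2‖ ≤ 9 / 8 := by
      rw [show ((1 - δ : ℝ) : ℂ) - 2 = ((-(1 + δ) : ℝ) : ℂ) by push_cast; ring, norm_real,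
        norm_neg, Real.norm_of_nonneg (by linarith)]
      linarith
    calc _ ≤ (k ! : ℝ)⁻¹ * ((9 / 8) ^ k * (k ! * M / (3 / 2) ^ k)) := by gcongr
      _ = M * (3 / 4) ^ k := by
        have h3 : (3 / 4 : ℝ) ^ k = (9 / 8) ^ k / (3 / 2) ^ k := by rw [← div_pow]; norm_num
        have : (k ! : ℝ) ≠ 0 := by exact_mod_cast k.factorial_ne_zero
        rw [h3, mul_div_assoc, mul_left_comm, inv_mul_cancel_left₀ this]
        ring
  have hg : HasSum (fun k : ℕ => M * (3 / 4 : ℝ) ^ (k + n)) (4 * M * (3 / 4) ^ n) := by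
    have := (hasSum_geometric_of_lt_one (r := 3 / 4) (by norm_num) (by norm_num)).mul_left
      (M * (3 / 4) ^ n)
    rw [show M * (3 / 4 : ℝ) ^ n * (1 - 3 / 4)⁻¹ = 4 * M * (3 / 4) ^ n by ring] at this
    exact this.congr_fun fun k => by rw [pow_add]; ring
  have htail : -(4 * M * (3 / 4) ^ n) ≤ ∑' k, (b (k + n) - l) * (1 + δ) ^ (k + n) := by
    rw [← hg.neg.tsum_eq]
    exact hg.neg.summable.tsum_le_tsum (fun k => neg_le_of_abs_le (hbound (k + n)))
      ((summable_nat_add_iff n).2 htay.summable)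
  have hfin : 1 - l * (1 + δ) ^ n / δ + l / δ ≤ ∑ k ∈ range n, (b k - l) * (1 + δ) ^ k := by
    have h1 : (1 : ℝ) ≤ ∑ k ∈ range n, b k * (1 + δ) ^ k := by
      refine le_trans ?_ (single_le_sum (f := fun k => b k * (1 + δ) ^ k)
        (fun k _ => mul_nonneg (hb0 k) (by positivity)) (mem_range.2 (Nat.pos_of_ne_zero hn)))
      simpa using hb1
    have h2 : ∑ k ∈ range n, (1 + δ) ^ k = ((1 + δ) ^ n - 1) / δ := by
      rw [geom_sum_eq (by linarith)]; simp
    simp only [sub_mul, sum_sub_distrib, ← mul_sum, h2]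
    have : l * (((1 + δ) ^ n - 1) / δ) = l * (1 + δ) ^ n / δ - l / δ := by ring
    linarith
  have := htay.summable.sum_add_tsum_nat_add n
  rw [htay.tsum_eq] at this
  rw [← this]
  linarith

end

section

open Finset Filter Topology MeasureTheory Complex
open scoped ComplexOrder Nat

lemma riemannZeta_ofReal_im (x : ℝ) : (riemannZeta x).im = 0 := by
  rw [← conj_eq_iff_im, ← riemannZeta_conj, conj_ofReal]

lemma riemannZeta_ofReal_re_pos {x : ℝ} (hx : 1 < x) : 0 < (riemannZeta x).re := by
  rw [← LSeries_one_eq_riemannZeta (s := x) (by simpa using hx)]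
  exact zero_lt_one.trans_le (LSeries.one_le_re_of_nonneg (fun _ => zero_le_one) rfl
    (LSeriesSummable_one_iff.2 (by simpa using hx)) (by simp))

lemma eventually_riemannZeta_ofReal_re_neg :
    ∀ᶠ x : ℝ in 𝓝[<] 1, (riemannZeta x).re < 0 := by
  have h1 : Tendsto (fun x : ℝ => (x : ℂ)) (𝓝[<] 1) (𝓝[≠] 1) := by
    refine tendsto_nhdsWithin_iff.2 ⟨?_, ?_⟩
    · exact (continuous_ofReal.tendsto' 1 1 (by simp)).mono_left nhdsWithin_le_nhds
    · filter_upwards [self_mem_nhdsWithin] with x hx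
      simpa using (ne_of_lt hx : x ≠ 1)
  have h2 := (continuous_re.tendsto 1).comp (riemannZeta_residue_one.comp h1)
  have h3 := h2.eventually (lt_mem_nhds (show (0 : ℝ) < (1 : ℂ).re by simp))
  filter_upwards [h3, self_mem_nhdsWithin] with x hx hx1
  simp only [Function.comp_apply] at hx
  rw [show (x : ℂ) - 1 = ((x - 1 : ℝ) : ℂ) by push_cast; rfl, re_ofReal_mul] at hx
  have : x - 1 < 0 := sub_neg.2 hx1
  by_contra! h
  nlinarith

namespace DirichletCharacter

variable {q : ℕ} {χ : DirichletCharacter ℂ q}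

lemma conj_apply_of_sq_eq_one (hχ : χ ^ 2 = 1) (a : ZMod q) : (starRingEnd ℂ) (χ a) = χ a := by
  rcases MulChar.isQuadratic_iff_sq_eq_one.mpr hχ a with h | h | h <;> simp [h]

variable [NeZero q]

lemma LFunction_ofReal_im (hχ1 : χ ≠ 1) (hχ : χ ^ 2 = 1) {x : ℝ} (hx : 0 < x) :
    (LFunction χ x).im = 0 := by
  rw [← conj_eq_iff_im, LFunction_eq_mul_integral hχ1 (by simpa using hx), map_mul, conj_ofReal,
    ← integral_conj]
  congr 1
  refine setIntegral_congr_fun measurableSet_Ioi fun t ht => ?_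
  have ht0 : (0 : ℝ) ≤ t := (zero_lt_one.trans ht).le
  have : ((t : ℂ) ^ (-((x : ℂ) + 1))) = ((t ^ (-(x + 1)) : ℝ) : ℂ) := by
    rw [ofReal_cpow ht0]; push_cast; rfl
  simp only [partialSum, map_mul, map_sum, conj_apply_of_sq_eq_one hχ, this, conj_ofReal]

lemma LFunction_ofReal_re_pos (hχ1 : χ ≠ 1) (hχ : χ ^ 2 = 1) {x : ℝ} (hx : 1 ≤ x) :
    0 < (LFunction χ x).re := by
  have key (y : ℝ) (hy : 1 < y) : 0 < (LFunction χ y).re := by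
    have hy' : 1 < (y : ℂ).re := by simpa using hy
    have h1 : LSeries (zetaMul χ) y = riemannZeta y * LFunction χ y := by
      rw [zetaMul, ArithmeticFunction.LSeries_mul'
        (by simpa [ArithmeticFunction.natCoe_apply] using
          ArithmeticFunction.LSeriesSummable_zeta_iff.mpr hy') (LSeriesSummable_arith χ hy'),
        ← ArithmeticFunction.LSeries_zeta_eq_riemannZeta hy']
      congr 1
      exact LSeries_arith χ hy'
    have h2 := LSeries.one_le_re_of_nonneg (a := zetaMul χ) (fun n => zetaMul_nonneg hχ n)
      ((ArithmeticFunction.isMultiplicative_zeta.natCast).mul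
        (isMultiplicative_toArithmeticFunction χ)).1
      (LSeriesSummable_zetaMul χ hy') (by simp)
    rw [h1, mul_re, riemannZeta_ofReal_im, zero_mul, sub_zero] at h2
    exact pos_of_mul_pos_right (zero_lt_one.trans_le h2) (riemannZeta_ofReal_re_pos hy).le
  have hc : Continuous fun x : ℝ => (LFunction χ x).re :=
    continuous_re.comp ((differentiable_LFunction hχ1).continuous.comp continuous_ofReal)
  rcases hx.eq_or_lt with rfl | hx
  · have h0 : 0 ≤ (LFunction χ (1 : ℝ)).re := by
      refine ge_of_tendsto (hc.continuousWithinAt (s := Set.Ioi 1) (x := 1)) ?_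
      filter_upwards [self_mem_nhdsWithin] with y hy using (key y hy).le
    refine lt_of_le_of_ne h0 fun h => LFunction_apply_one_ne_zero hχ1 ?_
    have := LFunction_ofReal_im hχ1 hχ zero_lt_one
    rw [ofReal_one] at this h
    exact Complex.ext h.symm this
  · exact key x hx

lemma LFunction_ofReal_re_pos_of_ne_zero (hχ1 : χ ≠ 1) (hχ : χ ^ 2 = 1) {x : ℝ} (hx : 0 < x)
    (h : ∀ y ∈ Set.Ico x 1, LFunction χ (y : ℂ) ≠ 0) : 0 < (LFunction χ x).re := by
  rcases le_or_gt 1 x with h1 | h1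
  · exact LFunction_ofReal_re_pos hχ1 hχ h1
  by_contra! hn
  have hc : Continuous fun x : ℝ => (LFunction χ x).re :=
    continuous_re.comp ((differentiable_LFunction hχ1).continuous.comp continuous_ofReal)
  obtain ⟨y, hy, hy0⟩ := intermediate_value_Icc h1.le hc.continuousOn
    ⟨hn, (LFunction_ofReal_re_pos hχ1 hχ le_rfl).le⟩
  have hy1 : y ≠ 1 := by
    rintro rfl
    exact (LFunction_ofReal_re_pos hχ1 hχ le_rfl).ne' hy0
  exact h y ⟨hy.1, lt_of_le_of_ne hy.2 hy1⟩
    (Complex.ext hy0 (LFunction_ofReal_im hχ1 hχ (hx.trans_le hy.1)))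

lemma exists_estermann_bound : ∃ A : ℝ, 0 < A ∧ ∀ {q₁ q₂ q₃ : ℕ} [NeZero q₁] [NeZero q₂] [NeZero q₃]
    {χ : DirichletCharacter ℂ q₁} {ψ : DirichletCharacter ℂ q₂} {θ : DirichletCharacter ℂ q₃},
    χ ≠ 1 → ψ ≠ 1 → θ ≠ 1 → χ ^ 2 = 1 → ψ ^ 2 = 1 → (∀ n : ℕ, θ n = χ n * ψ n) →
    ∀ {l : ℝ}, LFunction χ 1 * LFunction ψ 1 * LFunction θ 1 = l →
    ∀ {δ : ℝ}, 0 < δ → δ ≤ 1 / 8 → ∀ {n : ℕ}, n ≠ 0 →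
    1 - l * (1 + δ) ^ n / δ - A * (q₁ * q₂ * q₃) * (3 / 4) ^ n ≤
      (riemannZeta (1 - δ : ℝ) * (LFunction χ (1 - δ : ℝ) * LFunction ψ (1 - δ : ℝ) *
        LFunction θ (1 - δ : ℝ))).re := by
  set Z : ℂ → ℂ := LFunctionTrivChar₁ 1 with hZ
  have hZd : Differentiable ℂ Z := differentiable_LFunctionTrivChar₁ 1
  have hZ1 : Z 1 = 1 := by simp [hZ, LFunctionTrivChar₁]
  have hZne (s : ℂ) (hs : s ≠ 1) : Z s = (s - 1) * riemannZeta s := by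
    simp [hZ, LFunctionTrivChar₁, hs, LFunctionTrivChar, LFunction_modOne_eq]
  obtain ⟨B, hB⟩ := (isCompact_sphere (2 : ℂ) (3 / 2)).exists_bound_of_continuousOn
    hZd.continuous.continuousOn
  have hB0 : 0 ≤ B := (norm_nonneg _).trans (hB (2 + (3 / 2 : ℝ)) (by simp))
  refine ⟨4 * (2 * (B * 14 ^ 3 + 8)), by positivity, ?_⟩
  intro q₁ q₂ q₃ _ _ _ χ ψ θ hχ1 hψ1 hθ1 hχ hψ hθ l hl δ hδ hδ' n hn
  set P : ℂ → ℂ := fun s => LFunction χ s * LFunction ψ s * LFunction θ s with hP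
  have hPd : Differentiable ℂ P := ((differentiable_LFunction hχ1).mul
    (differentiable_LFunction hψ1)).mul (differentiable_LFunction hθ1)
  set H : ℂ → ℂ := dslope (fun s => Z s * P s) 1 with hH
  have hHd : Differentiable ℂ H := by
    rw [← differentiableOn_univ, hH, Complex.differentiableOn_dslope Filter.univ_mem]
    exact (hZd.mul hPd).differentiableOn
  have hHs (s : ℂ) (hs : s ≠ 1) : H s = (s - 1)⁻¹ * (Z s * P s - l) := by
    rw [hH, dslope_of_ne _ hs, slope_def_module, smul_eq_mul, hZ1, one_mul, ← hl]
  have hHs' (s : ℂ) (hs : s ≠ 1) : H s = riemannZeta s * P s - l * (s - 1)⁻¹ := by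
    rw [hHs s hs, hZne s hs]
    have : s - 1 ≠ 0 := sub_ne_zero.2 hs
    field_simp
  have hln : ‖(l : ℂ)‖ ≤ 8 * (q₁ * q₂ * q₃) := by
    rw [← hl, norm_mul, norm_mul]
    have b1 := norm_LFunction_le hχ1 (s := 1) (by simp)
    have b2 := norm_LFunction_le hψ1 (s := 1) (by simp)
    have b3 := norm_LFunction_le hθ1 (s := 1) (by simp)
    simp only [norm_one, one_re, mul_one, div_one] at b1 b2 b3
    calc _ ≤ (2 * q₁ : ℝ) * (2 * q₂) * (2 * q₃) := by gcongr
      _ = _ := by ring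
  have hM : ∀ s ∈ Metric.sphere (2 : ℂ) (3 / 2), ‖H s‖ ≤
      2 * (B * 14 ^ 3 + 8) * (q₁ * q₂ * q₃) := by
    intro s hs
    have hs' : ‖s - 2‖ = 3 / 2 := by simpa [dist_eq_norm] using hs
    have hre : 1 / 2 ≤ s.re := by
      have := (abs_re_le_norm (s - 2)).trans_eq hs'
      rw [abs_le] at this
      simp at this
      linarith
    have hns : ‖s‖ ≤ 7 / 2 := by
      have := norm_add_le (s - 2) 2
      rw [sub_add_cancel, hs'] at this
      norm_num at this
      linarith
    have hs1 : 1 / 2 ≤ ‖s - 1‖ := by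
      have := norm_sub_le (s - 1) 1
      rw [show s - 1 - 1 = s - 2 by ring, hs', norm_one] at this
      linarith
    have hne : s ≠ 1 := by rintro rfl; norm_num at hs1
    have hL {q : ℕ} [NeZero q] {χ : DirichletCharacter ℂ q} (hχ : χ ≠ 1) :
        ‖LFunction χ s‖ ≤ 14 * q := by
      refine (norm_LFunction_le hχ (by linarith)).trans ?_
      rw [div_le_iff₀ (by linarith)]
      calc 2 * (q : ℝ) * ‖s‖ ≤ 2 * q * (7 / 2) := by gcongr
        _ = 14 * q * (1 / 2) := by ring
        _ ≤ _ := by gcongr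
    rw [hHs s hne, norm_mul, norm_inv]
    have hi : ‖s - 1‖⁻¹ ≤ 2 := by
      rw [inv_le_comm₀ (by linarith) two_pos]; linarith
    have hZP : ‖Z s * P s - l‖ ≤ B * ((14 * q₁) * (14 * q₂) * (14 * q₃)) + 8 * (q₁ * q₂ * q₃) := by
      refine (norm_sub_le _ _).trans (add_le_add ?_ hln)
      rw [norm_mul, hP, norm_mul, norm_mul]
      have b1 := hL hχ1
      have b2 := hL hψ1
      have b3 := hL hθ1
      have b4 := hB s hs
      gcongr
    calc _ ≤ 2 * (B * ((14 * q₁) * (14 * q₂) * (14 * q₃)) + 8 * (q₁ * q₂ * q₃)) := by gcongr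
      _ = _ := by ring
  have hδne : ((1 - δ : ℝ) : ℂ) ≠ 1 := by
    rw [← ofReal_one, Ne, ofReal_inj]; linarith
  have h := LSeries.estermann_le (a := quadMul χ ψ θ) (fun n => quadMul_nonneg hχ hψ hθ n)
    (quadMul_one χ ψ θ) (fun s hs => LSeriesSummable_quadMul χ ψ θ hs) hHd (l := l)
    (fun s hs => by
      rw [LSeries_quadMul χ ψ θ hs, hHs' s (by rintro rfl; simp at hs)]) hM hδ hδ' hn
  rw [hHs' _ hδne, sub_re, show ((1 - δ : ℝ) : ℂ) - 1 = ((-δ : ℝ) : ℂ) by push_cast; ring,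
    ← ofReal_inv, ← ofReal_mul, ofReal_re] at h
  have e : l * (-δ)⁻¹ = -(l / δ) := by rw [inv_neg]; ring
  rw [e] at h
  linarith

end DirichletCharacter

end

section

open Finset Filter Topology MeasureTheory Complex
open scoped ComplexOrder Nat

namespace DirichletCharacter

lemma half_le_of_estermann {A : ℝ} (hA : 1 ≤ A) {l δ : ℝ} (hδ : 0 < δ)
    (h : ∀ n : ℕ, n ≠ 0 → 1 - l * (1 + δ) ^ n / δ - A * (3 / 4) ^ n ≤ 0) :
    δ / (2 * Real.exp (2 * δ) * (2 * A) ^ (4 * δ)) ≤ l := by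
  have hlog : 1 / 4 ≤ Real.log (4 / 3) := by
    have := Real.one_sub_inv_le_log_of_pos (show (0 : ℝ) < 4 / 3 by norm_num)
    norm_num at this ⊢
    exact this
  have hlA : 0 ≤ Real.log (2 * A) := Real.log_nonneg (by linarith)
  set n := ⌈Real.log (2 * A) / Real.log (4 / 3)⌉₊ + 1 with hn
  have hn1 : (n : ℝ) ≤ 4 * Real.log (2 * A) + 2 := by
    have h1 := (Nat.ceil_lt_add_one (a := Real.log (2 * A) / Real.log (4 / 3))
      (div_nonneg hlA (by linarith))).le
    have h2 : Real.log (2 * A) / Real.log (4 / 3) ≤ 4 * Real.log (2 * A) := by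
      rw [div_le_iff₀ (by linarith)]
      nlinarith
    rw [hn]; push_cast; linarith
  have hn2 : A * (3 / 4) ^ n ≤ 1 / 2 := by
    have h1 : Real.log (2 * A) / Real.log (4 / 3) ≤ n := by
      refine (Nat.le_ceil _).trans ?_
      exact_mod_cast Nat.le_succ _
    rw [div_le_iff₀ (by linarith), ← Real.log_pow, Real.log_le_log_iff (by linarith)
      (by positivity)] at h1
    have h2 : (3 / 4 : ℝ) ^ n * (4 / 3) ^ n = 1 := by rw [← mul_pow]; norm_num
    have h3 : (0 : ℝ) < (3 / 4) ^ n := by positivity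
    nlinarith
  have h1 := h n (by omega)
  have hp : (1 + δ) ^ n ≤ Real.exp (2 * δ) * (2 * A) ^ (4 * δ) := by
    calc (1 + δ) ^ n ≤ Real.exp δ ^ n := by
          gcongr
          linarith [Real.add_one_le_exp δ]
      _ = Real.exp (n * δ) := by rw [← Real.exp_nat_mul]
      _ ≤ Real.exp ((4 * Real.log (2 * A) + 2) * δ) := by gcongr
      _ = _ := by
        rw [Real.rpow_def_of_pos (by linarith), ← Real.exp_add]
        congr 1; ring
  have h2 : 1 / 2 ≤ l * (1 + δ) ^ n / δ := by linarith
  have h3 : δ / 2 ≤ l * (1 + δ) ^ n := by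
    rw [le_div_iff₀ hδ] at h2; linarith
  have hl : 0 < l := by
    by_contra! hl
    have : 0 < (1 + δ) ^ n := by positivity
    nlinarith
  rw [div_le_iff₀ (by positivity)]
  nlinarith

variable {q₁ q₂ : ℕ}

lemma changeLevel_mul_changeLevel_natCast (χ : DirichletCharacter ℂ q₁)
    (ψ : DirichletCharacter ℂ q₂) (n : ℕ) :
    (changeLevel (Dvd.intro _ rfl) χ * changeLevel (Dvd.intro_left _ rfl) ψ :
      DirichletCharacter ℂ (q₁ * q₂)) n = χ n * ψ n := by
  by_cases hn : IsUnit (n : ZMod (q₁ * q₂))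
  · rw [MulChar.mul_apply]
    obtain ⟨u, hu⟩ := hn
    rw [← hu, changeLevel_eq_cast_of_dvd, changeLevel_eq_cast_of_dvd, hu,
      ZMod.cast_natCast (Dvd.intro _ rfl), ZMod.cast_natCast (Dvd.intro_left _ rfl)]
  · rw [MulChar.map_nonunit _ hn]
    rw [ZMod.isUnit_iff_coprime, Nat.coprime_mul_iff_right, ← ZMod.isUnit_iff_coprime,
      ← ZMod.isUnit_iff_coprime, not_and_or] at hn
    rcases hn with hn | hn <;> simp [MulChar.map_nonunit _ hn]

lemma changeLevel_mul_changeLevel_ne_one [NeZero q₁] [NeZero q₂] {χ : DirichletCharacter ℂ q₁}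
    {ψ : DirichletCharacter ℂ q₂} (hψ : ψ.IsPrimitive) (h : q₁ < q₂) :
    (changeLevel (Dvd.intro _ rfl) χ * changeLevel (Dvd.intro_left _ rfl) ψ :
      DirichletCharacter ℂ (q₁ * q₂)) ≠ 1 := by
  intro h1
  have h2 := eq_inv_of_mul_eq_one_right h1
  rw [← map_inv] at h2
  have h3 := congr_arg conductor h2
  rw [conductor_changeLevel, conductor_changeLevel, isPrimitive_def _ |>.1 hψ] at h3
  have := Nat.le_of_dvd (NeZero.pos q₁) (conductor_dvd_level χ⁻¹)
  omega

lemma exists_le_LFunction_one_of_level_le (m : ℕ) : ∃ c : ℝ, 0 < c ∧ ∀ q ≤ m, ∀ [NeZero q],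
    ∀ ψ : DirichletCharacter ℂ q, ψ ≠ 1 → ψ ^ 2 = 1 → c ≤ (LFunction ψ 1).re := by
  induction m with
  | zero => exact ⟨1, one_pos, fun q hq h => absurd (Nat.le_zero.1 hq) h.out⟩
  | succ m ih =>
    obtain ⟨c, hc, h⟩ := ih
    classical
    have hfin : Finite (DirichletCharacter ℂ (m + 1)) := inferInstance
    obtain ⟨ψ₀, hψ₀⟩ := Finite.exists_min (fun ψ : DirichletCharacter ℂ (m + 1) =>
      if ψ ≠ 1 ∧ ψ ^ 2 = 1 then (LFunction ψ 1).re else 1)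
    set d := (if ψ₀ ≠ 1 ∧ ψ₀ ^ 2 = 1 then (LFunction ψ₀ 1).re else 1) with hd
    have hd0 : 0 < d := by
      rw [hd]
      split_ifs with h
      · simpa using LFunction_ofReal_re_pos h.1 h.2 le_rfl
      · exact one_pos
    refine ⟨min c d, lt_min hc hd0, fun q hq _ ψ hψ1 hψ => ?_⟩
    rcases Nat.le_succ_iff.1 hq with hq | rfl
    · exact (min_le_left _ _).trans (h q hq ψ hψ1 hψ)
    · refine (min_le_right _ _).trans ?_
      simpa [hψ1, hψ] using hψ₀ ψ

lemma exists_nonpos_of_lt {δ₀ : ℝ} (hδ₀ : 0 < δ₀) (hδ₀' : δ₀ ≤ 1 / 8) :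
    ∃ (q₁ : ℕ) (_ : NeZero q₁) (χ : DirichletCharacter ℂ q₁) (δ : ℝ), χ ≠ 1 ∧ χ ^ 2 = 1 ∧
      0 < δ ∧ δ ≤ δ₀ ∧ ∀ (q₂ q₃ : ℕ) [NeZero q₂] [NeZero q₃] (ψ : DirichletCharacter ℂ q₂)
        (θ : DirichletCharacter ℂ q₃), ψ ≠ 1 → ψ ^ 2 = 1 → θ ≠ 1 → θ ^ 2 = 1 →
      (riemannZeta (1 - δ : ℝ) * (LFunction χ (1 - δ : ℝ) * LFunction ψ (1 - δ : ℝ) *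
        LFunction θ (1 - δ : ℝ))).re ≤ 0 := by
  by_cases hz : ∃ (q₁ : ℕ) (_ : NeZero q₁) (χ : DirichletCharacter ℂ q₁) (δ : ℝ), χ ≠ 1 ∧
      χ ^ 2 = 1 ∧ 0 < δ ∧ δ ≤ δ₀ ∧ LFunction χ (1 - δ : ℝ) = 0
  · obtain ⟨q₁, hq₁, χ, δ, hχ1, hχ, hδ, hδ', h⟩ := hz
    refine ⟨q₁, hq₁, χ, δ, hχ1, hχ, hδ, hδ', ?_⟩
    intro q₂ q₃ _ _ ψ θ _ _ _ _
    rw [h, zero_mul, zero_mul, mul_zero, zero_re]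
  · have h1 := eventually_riemannZeta_ofReal_re_neg
    rw [eventually_iff, mem_nhdsLT_iff_exists_Ioo_subset] at h1
    obtain ⟨a, ha, ha'⟩ := h1
    have ha1 : a < 1 := ha
    set δ := min δ₀ ((1 - a) / 2) with hδ
    have hδ0 : 0 < δ := lt_min hδ₀ (by linarith)
    have hpos {q : ℕ} [NeZero q] {χ : DirichletCharacter ℂ q} (h1 : χ ≠ 1) (h2 : χ ^ 2 = 1) :
        ∃ x : ℝ, 0 < x ∧ LFunction χ (1 - δ : ℝ) = x := by
      have hδ1 : δ ≤ δ₀ := min_le_left _ _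
      refine ⟨_, LFunction_ofReal_re_pos_of_ne_zero h1 h2 (x := 1 - δ) (by linarith) ?_,
        Complex.ext (by simp) (LFunction_ofReal_im h1 h2 (by linarith))⟩
      intro y hy h0
      refine hz ⟨q, inferInstance, χ, 1 - y, h1, h2, sub_pos.2 hy.2, ?_, by simpa using h0⟩
      linarith [hy.1]
    have h4 : (ZMod.χ₄.ringHomComp (Int.castRingHom ℂ) : DirichletCharacter ℂ 4) ≠ 1 := by
      intro h
      have := congr_arg (fun χ : DirichletCharacter ℂ 4 => χ 3) h
      have e : (1 : DirichletCharacter ℂ 4) 3 = 1 := by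
        have : IsUnit (3 : ZMod 4) := by decide
        exact MulChar.one_apply this
      simp only [e, MulChar.ringHomComp_apply] at this
      have e2 : ZMod.χ₄ 3 = -1 := by decide
      rw [e2] at this
      norm_num at this
    have h4' : (ZMod.χ₄.ringHomComp (Int.castRingHom ℂ) : DirichletCharacter ℂ 4) ^ 2 = 1 :=
      (ZMod.isQuadratic_χ₄.comp _).sq_eq_one
    refine ⟨4, inferInstance, _, δ, h4, h4', hδ0, min_le_left _ _, ?_⟩
    intro q₂ q₃ _ _ ψ θ hψ1 hψ hθ1 hθ
    obtain ⟨x, hx, ex⟩ := hpos h4 h4'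
    obtain ⟨y, hy, ey⟩ := hpos hψ1 hψ
    obtain ⟨z, hzz, ez⟩ := hpos hθ1 hθ
    rw [ex, ey, ez, ← ofReal_mul, ← ofReal_mul, re_mul_ofReal]
    have hneg : (riemannZeta (1 - δ : ℝ)).re < 0 := by
      refine ha' ⟨?_, by linarith⟩
      have : δ ≤ (1 - a) / 2 := min_le_right _ _
      linarith
    exact mul_nonpos_of_nonpos_of_nonneg hneg.le (by positivity)

/-- **Siegel's theorem** for primitive quadratic Dirichlet characters. -/
theorem siegel {ε : ℝ} (hε : 0 < ε) : ∃ C : ℝ, 0 < C ∧ ∀ (q : ℕ) [NeZero q]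
    (ψ : DirichletCharacter ℂ q), ψ.IsPrimitive → ψ ≠ 1 → ψ ^ 2 = 1 →
    C * (q : ℝ) ^ (-ε) ≤ (LFunction ψ 1).re := by
  wlog hε1 : ε ≤ 1 generalizing ε
  · obtain ⟨C, hC, h⟩ := this one_pos le_rfl
    refine ⟨C, hC, fun q _ ψ h1 h2 h3 => le_trans ?_ (h q ψ h1 h2 h3)⟩
    have : (1 : ℝ) ≤ q := by exact_mod_cast NeZero.pos q
    gcongr
    exact (not_le.1 hε1).le
  obtain ⟨A, hA, hest⟩ := exists_estermann_bound
  obtain ⟨q₁, _, χ, δ, hχ1, hχ, hδ, hδ', hF⟩ := exists_nonpos_of_lt (δ₀ := ε / 16) (by positivity)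
    (by linarith)
  obtain ⟨c, hc, hfin⟩ := exists_le_LFunction_one_of_level_le q₁
  set K := (LFunction χ 1).re with hK
  have hK0 : 0 < K := by simpa using LFunction_ofReal_re_pos hχ1 hχ le_rfl
  have hq₁ : (1 : ℝ) ≤ q₁ := by exact_mod_cast NeZero.pos q₁
  set B := max A 1 with hB
  have hB1 : 1 ≤ B := le_max_right _ _
  set C := δ / (2 * Real.exp (2 * δ) * (2 * (B * q₁ ^ 2)) ^ (4 * δ)) /
    (K * ((2 * q₁) ^ (ε / 2) / (ε / 2))) with hC
  have hC0 : 0 < C := by positivity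
  refine ⟨min c C, lt_min hc hC0, ?_⟩
  intro q _ ψ hprim hψ1 hψ
  have hq : (1 : ℝ) ≤ q := by exact_mod_cast NeZero.pos q
  rcases le_or_gt q q₁ with hle | hlt
  · refine le_trans ?_ (hfin q hle ψ hψ1 hψ)
    calc min c C * (q : ℝ) ^ (-ε) ≤ c * 1 := by
          gcongr
          · exact min_le_left _ _
          · exact Real.rpow_le_one_of_one_le_of_nonpos hq (by linarith)
      _ = c := mul_one c
  set θ : DirichletCharacter ℂ (q₁ * q) :=
    changeLevel (Dvd.intro _ rfl) χ * changeLevel (Dvd.intro_left _ rfl) ψ with hθ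
  have hθ1 : θ ≠ 1 := changeLevel_mul_changeLevel_ne_one hprim hlt
  have hθ2 : θ ^ 2 = 1 := by rw [hθ, mul_pow, ← map_pow, ← map_pow, hχ, hψ]; simp
  have hre {r : ℕ} [NeZero r] {χ : DirichletCharacter ℂ r} (h1 : χ ≠ 1) (h2 : χ ^ 2 = 1) :
      LFunction χ 1 = (LFunction χ 1).re :=
    Complex.ext (by simp) (by simpa using LFunction_ofReal_im h1 h2 one_pos)
  have hmain : δ / (2 * Real.exp (2 * δ) * (2 * (B * (q₁ * q) ^ 2)) ^ (4 * δ)) ≤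
      K * (LFunction ψ 1).re * (LFunction θ 1).re := by
    refine half_le_of_estermann ?_ hδ fun n hn => ?_
    · have : 1 ≤ ((q₁ : ℝ) * q) ^ 2 := one_le_pow₀ (one_le_mul_of_one_le_of_one_le hq₁ hq)
      exact one_le_mul_of_one_le_of_one_le hB1 this
    · have h1 := (hest hχ1 hψ1 hθ1 hχ hψ (changeLevel_mul_changeLevel_natCast χ ψ)
        (l := K * (LFunction ψ 1).re * (LFunction θ 1).re) (by
          rw [hre hχ1 hχ, hre hψ1 hψ, hre hθ1 hθ2]; push_cast; rfl) hδ (by linarith) hn).trans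
        (hF q (q₁ * q) ψ θ hψ1 hψ hθ1 hθ2)
      refine le_trans ?_ h1
      have : A * (q₁ * q * ((q₁ * q : ℕ) : ℝ)) ≤ B * (q₁ * q) ^ 2 := by
        push_cast
        calc A * (q₁ * q * ((q₁ * q : ℝ))) ≤ B * (q₁ * q * ((q₁ * q : ℝ))) := by
              gcongr; exact le_max_left _ _
          _ = _ := by ring
      gcongr
  have hθb : (LFunction θ 1).re ≤ (2 * q₁) ^ (ε / 2) / (ε / 2) * (q : ℝ) ^ (ε / 2) := by
    refine (re_le_norm _).trans ((norm_LFunction_one_le hθ1 (half_pos hε)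
      (by linarith)).trans_eq ?_)
    push_cast
    rw [← mul_assoc, Real.mul_rpow (by positivity) (by positivity)]
    ring
  have hψ0 : 0 < (LFunction ψ 1).re := by simpa using LFunction_ofReal_re_pos hψ1 hψ le_rfl
  have hexp : (2 * (B * (q₁ * q : ℝ) ^ 2)) ^ (4 * δ) ≤
      (2 * (B * q₁ ^ 2)) ^ (4 * δ) * (q : ℝ) ^ (ε / 2) := by
    rw [show 2 * (B * (q₁ * q : ℝ) ^ 2) = (2 * (B * q₁ ^ 2)) * (q : ℝ) ^ (2 : ℝ) by
      rw [Real.rpow_two]; ring, Real.mul_rpow (by positivity) (by positivity),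
      ← Real.rpow_mul (by positivity)]
    gcongr
    linarith
  have hqe : (q : ℝ) ^ (-ε) * ((q : ℝ) ^ (ε / 2) * (q : ℝ) ^ (ε / 2)) = 1 := by
    rw [← Real.rpow_add (by positivity), ← Real.rpow_add (by positivity)]
    norm_num
  set X := (q : ℝ) ^ (ε / 2) with hX
  have hX0 : 0 < X := by positivity
  set D := (2 * q₁ : ℝ) ^ (ε / 2) / (ε / 2) with hD
  have hD0 : 0 < D := by positivity
  set E := (2 * (B * q₁ ^ 2)) ^ (4 * δ) with hE
  have hE0 : 0 < E := by positivity
  have hfinal : C * (q : ℝ) ^ (-ε) ≤ (LFunction ψ 1).re := by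
    have h1 : δ / (2 * Real.exp (2 * δ) * (E * X)) ≤ K * (LFunction ψ 1).re * (D * X) := by
      refine le_trans ?_ (hmain.trans ?_)
      · gcongr
      · gcongr
    have h2 : C * (q : ℝ) ^ (-ε) = δ / (2 * Real.exp (2 * δ) * (E * X)) / (K * (D * X)) := by
      rw [hC]
      have : (q : ℝ) ^ (-ε) = (X * X)⁻¹ := eq_inv_of_mul_eq_one_left hqe
      rw [this]
      field_simp
    rw [h2, div_le_iff₀ (by positivity)]
    linarith
  refine le_trans ?_ hfinal
  gcongr
  exact min_le_right _ _

end DirichletCharacter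

end

section

open Finset Filter Topology Complex
open scoped Real

lemma Complex.ofReal_mul_cpow {a : ℝ} (ha : 0 < a) {z : ℂ} (hz : z ≠ 0) (r : ℂ) :
    (a * z) ^ r = (a : ℂ) ^ r * z ^ r := by
  have ha' : (a : ℂ) ≠ 0 := by exact_mod_cast ha.ne'
  rw [cpow_def_of_ne_zero (mul_ne_zero ha' hz), cpow_def_of_ne_zero ha', cpow_def_of_ne_zero hz,
    log_ofReal_mul ha hz, ofReal_log ha.le, add_mul, Complex.exp_add]

lemma tendsto_jacobiTheta₂_one {ι : Type*} {l : Filter ι} (x : ℝ) {τ : ι → ℂ}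
    (hτ : Tendsto (fun i => (τ i).im) l atTop) :
    Tendsto (fun i => jacobiTheta₂ x (τ i)) l (𝓝 1) := by
  have hsum : Summable fun n : ℤ => ‖jacobiTheta₂_term n 0 I‖ :=
    ((summable_jacobiTheta₂_term_iff 0 I).2 (by simp)).norm
  have h1 : ∑' n : ℤ, (if n = 0 then (1 : ℂ) else 0) = 1 := tsum_ite_eq 0 (fun _ => (1 : ℂ))
  rw [← h1]
  refine tendsto_tsum_of_dominated_convergence hsum (fun n => ?_) ?_
  · split_ifs with hn
    · simpa [hn, jacobiTheta₂_term] using tendsto_const_nhds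
    · rw [tendsto_zero_iff_norm_tendsto_zero]
      simp only [norm_jacobiTheta₂_term, ofReal_im, mul_zero, sub_zero]
      refine Real.tendsto_exp_atBot.comp ?_
      refine hτ.const_mul_atTop_of_neg ?_
      have : (0 : ℝ) < (n : ℝ) ^ 2 := by positivity
      nlinarith [Real.pi_pos]
  · filter_upwards [hτ.eventually_ge_atTop 1] with i hi n
    rw [norm_jacobiTheta₂_term, norm_jacobiTheta₂_term]
    simp only [ofReal_im, mul_zero, sub_zero, I_im, zero_im]
    refine Real.exp_le_exp.2 ?_
    nlinarith [mul_le_mul_of_nonneg_left hi (show 0 ≤ π * (n : ℝ) ^ 2 by positivity)]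

/-- A Gaussian sum with periodic weights, split into residue classes and transformed by Poisson
summation. -/
lemma hasSum_periodic_gaussian {N : ℕ} [NeZero N] (c : ZMod N → ℂ) {z : ℂ} (hz : 0 < z.re) :
    HasSum (fun n : ℤ => c n * cexp (-π * z * n ^ 2))
      ((1 / (N * z ^ (1 / 2 : ℂ))) *
        ∑ r : Fin N, c (r : ℕ) * jacobiTheta₂ ((r : ℝ) / N : ℝ) (I / (z * N ^ 2))) := by
  have hz0 : z ≠ 0 := by rintro rfl; simp at hz
  have hN : (N : ℂ) ≠ 0 := NeZero.ne _
  have hNr : (0 : ℝ) < N := by exact_mod_cast NeZero.pos N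
  have hclass (r : Fin N) : HasSum (fun m : ℤ => cexp (-π * z * ((m * N + (r : ℕ) : ℤ) : ℂ) ^ 2))
      (1 / (N * z ^ (1 / 2 : ℂ)) * jacobiTheta₂ ((r : ℝ) / N : ℝ) (I / (z * N ^ 2))) := by
    have him : 0 < (I * z * N ^ 2).im := by
      rw [show I * z * N ^ 2 = I * (((N ^ 2 : ℝ) : ℂ) * z) by push_cast; ring]
      rw [I_mul_im, re_ofReal_mul]
      positivity
    have h := (hasSum_jacobiTheta₂_term (I * z * N * r) him).mul_left (cexp (-π * z * r ^ 2))
    rw [jacobiTheta₂_functional_equation] at h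
    have e1 : -I * (I * z * N ^ 2) = ((N ^ 2 : ℝ) : ℂ) * z := by
      push_cast; linear_combination -z * N ^ 2 * I_sq
    have e2 : (((N ^ 2 : ℝ) : ℂ) * z) ^ (1 / 2 : ℂ) = N * z ^ (1 / 2 : ℂ) := by
      rw [ofReal_mul_cpow (by positivity) hz0, show (1 / 2 : ℂ) = ((1 / 2 : ℝ) : ℂ) by simp,
        ← ofReal_cpow (by positivity), ← Real.sqrt_eq_rpow, Real.sqrt_sq hNr.le, ofReal_natCast]
    have e3 : -1 / (I * z * N ^ 2) = I / (z * N ^ 2) := by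
      field_simp
      simp
    have e4 : I * z * N * r / (I * z * N ^ 2) = (((r : ℝ) / N : ℝ) : ℂ) := by
      have := I_ne_zero
      push_cast
      field_simp
    have e5 :
        cexp (-π * z * r ^ 2) * cexp (-π * I * (I * z * N * r) ^ 2 / (I * z * N ^ 2)) = 1 := by
      rw [← Complex.exp_add, Complex.exp_eq_one_iff]
      refine ⟨0, ?_⟩
      have := I_ne_zero
      field_simp
      simp
    rw [e1, e2, e3, e4] at h
    rw [show cexp (-π * z * r ^ 2) * (1 / (N * z ^ (1 / 2 : ℂ)) *
      cexp (-π * I * (I * z * N * r) ^ 2 / (I * z * N ^ 2)) *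
        jacobiTheta₂ (((r : ℝ) / N : ℝ) : ℂ) (I / (z * N ^ 2))) =
      (cexp (-π * z * r ^ 2) * cexp (-π * I * (I * z * N * r) ^ 2 / (I * z * N ^ 2))) *
      (1 / (N * z ^ (1 / 2 : ℂ)) *
        jacobiTheta₂ (((r : ℝ) / N : ℝ) : ℂ) (I / (z * N ^ 2))) by ring, e5, one_mul] at h
    refine h.congr_fun fun m => ?_
    rw [jacobiTheta₂_term, ← Complex.exp_add]
    congr 1
    push_cast
    linear_combination (-(2 * π * m * z * N * r) - π * m ^ 2 * z * N ^ 2) * I_sq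
  have hsummable : Summable fun n : ℤ => c n * cexp (-π * z * n ^ 2) := by
    have h0 : 0 < (I * z).im := by simpa using hz
    have h1 := ((summable_jacobiTheta₂_term_iff 0 (I * z)).2 h0).norm
    refine Summable.of_norm_bounded (h1.mul_left (∑ a, ‖c a‖)) fun n => ?_
    rw [norm_mul]
    refine mul_le_mul (single_le_sum (f := fun a => ‖c a‖) (fun _ _ => norm_nonneg _) (mem_univ _))
      (le_of_eq ?_) (norm_nonneg _) (sum_nonneg fun _ _ => norm_nonneg _)
    congr 1
    rw [jacobiTheta₂_term]
    congr 1
    linear_combination (-π * n ^ 2 * z) * I_sq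
  have hs2 := (Int.divModEquiv N).symm.summable_iff.2 hsummable
  have hs3 : HasSum (fun y : Fin N × ℤ => c ((y.1 : ℕ) : ZMod N) *
      cexp (-π * z * ((y.2 * N + (y.1 : ℕ) : ℤ) : ℂ) ^ 2))
      (∑' n : ℤ, c n * cexp (-π * z * n ^ 2)) := by
    have := ((Equiv.prodComm (Fin N) ℤ).trans (Int.divModEquiv N).symm).hasSum_iff.2
      hsummable.hasSum
    convert this using 2 with y
    simp [Int.divModEquiv]
  have hs4 := hs3.prod_fiberwise (fun r => (hclass r).mul_left (c ((r : ℕ) : ZMod N)))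
  have hs5 := hs4.unique (hasSum_fintype _)
  convert hsummable.hasSum using 1
  rw [hs5, mul_sum]
  refine sum_congr rfl fun r _ => ?_
  ring

lemma tendsto_periodic_gaussian {N : ℕ} [NeZero N] (c : ZMod N → ℂ) {ι : Type*} {l : Filter ι}
    {z : ι → ℂ} (hz : ∀ᶠ i in l, 0 < (z i).re) (hz' : Tendsto (fun i => ((z i)⁻¹).re) l atTop) :
    Tendsto (fun i => N * z i ^ (1 / 2 : ℂ) * ∑' n : ℤ, c n * cexp (-π * z i * n ^ 2)) l
      (𝓝 (∑ a, c a)) := by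
  have hNr : (0 : ℝ) < N := by exact_mod_cast NeZero.pos N
  have h : Tendsto (fun i => ∑ r : Fin N, c (r : ℕ) *
      jacobiTheta₂ ((r : ℝ) / N : ℝ) (I / (z i * N ^ 2))) l (𝓝 (∑ r : Fin N, c (r : ℕ) * 1)) := by
    refine tendsto_finsetSum _ fun r _ => (tendsto_jacobiTheta₂_one _ ?_).const_mul _
    have : ∀ i, (I / (z i * N ^ 2)).im = ((z i)⁻¹).re * (1 / (N : ℝ) ^ 2) := fun i => by
      rw [show I / (z i * N ^ 2) = I * (((1 / N ^ 2 : ℝ) : ℂ) * (z i)⁻¹) by push_cast; ring,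
        I_mul_im, re_ofReal_mul]
      ring
    simp only [this]
    exact hz'.atTop_mul_const (by positivity)
  have e : ∑ r : Fin N, c (r : ℕ) * 1 = ∑ a, c a := by
    simp only [mul_one]
    refine Fintype.sum_equiv (ZMod.finEquiv N).toEquiv _ _ fun r => ?_
    congr 1
    obtain ⟨n, rfl⟩ : ∃ n, N = n + 1 := ⟨N - 1, by have := NeZero.pos N; omega⟩
    exact Fin.cast_val_eq_self r
  rw [e] at h
  refine h.congr' ?_
  filter_upwards [hz] with i hi
  have hz0 : z i ≠ 0 := by rintro h; simp [h] at hi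
  have hN : (N : ℂ) ≠ 0 := NeZero.ne _
  have h1 : z i ^ (1 / 2 : ℂ) ≠ 0 := by simp [cpow_eq_zero_iff, hz0]
  rw [(hasSum_periodic_gaussian c hi).tsum_eq, ← mul_assoc, mul_one_div_cancel (mul_ne_zero hN h1),
    one_mul]

end

section

open Finset Filter Topology Complex
open scoped Real

lemma jacobiTheta₂_zero_rational_add {N : ℕ} [NeZero N] (t : ℂ) :
    jacobiTheta₂ 0 (2 / N + I * t) =
      ∑' n : ℤ, ZMod.stdAddChar ((n : ZMod N) ^ 2) * cexp (-π * t * n ^ 2) := by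
  refine tsum_congr fun n => ?_
  have : (n : ZMod N) ^ 2 = ((n ^ 2 : ℤ) : ZMod N) := by push_cast; rfl
  rw [this, ZMod.stdAddChar_coe, jacobiTheta₂_term, ← Complex.exp_add]
  congr 1
  push_cast
  linear_combination π * n ^ 2 * t * I_sq

lemma jacobiTheta₂_zero_neg_half_add (N : ℕ) (w : ℂ) :
    jacobiTheta₂ 0 (-(N / 2) + I * w) =
      ∑' n : ℤ, (if (n : ZMod 2) = 0 then 1 else (-I) ^ N) * cexp (-π * w * n ^ 2) := by
  refine tsum_congr fun n => ?_
  have h1 : jacobiTheta₂_term n 0 (-(N / 2) + I * w) =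
      cexp (-(π * I * n ^ 2 * N / 2)) * cexp (-π * w * n ^ 2) := by
    rw [jacobiTheta₂_term, ← Complex.exp_add]
    congr 1
    linear_combination π * n ^ 2 * w * I_sq
  rw [h1]
  congr 1
  have hdvd : ((n : ZMod 2) = 0) ↔ Even n := by
    rw [ZMod.intCast_zmod_eq_zero_iff_dvd, even_iff_two_dvd]; rfl
  rcases Int.even_or_odd n with hn | hn
  · rw [if_pos (hdvd.2 hn), Complex.exp_eq_one_iff]
    obtain ⟨k, rfl⟩ := hn
    refine ⟨-(k ^ 2 * N), ?_⟩
    push_cast; ring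
  · rw [if_neg (fun h => Int.not_even_iff_odd.2 hn (hdvd.1 h))]
    obtain ⟨k, rfl⟩ := hn
    have hI : (-I) = cexp (-(π / 2) * I) := by
      rw [neg_mul, Complex.exp_neg, exp_pi_div_two_mul_I, inv_I]
    rw [hI, ← Complex.exp_nat_mul, Complex.exp_eq_exp_iff_exists_int]
    refine ⟨-((k ^ 2 + k) * N), ?_⟩
    push_cast; ring

/-- The quadratic Gauss sum, including its sign. -/
theorem ZMod.sum_stdAddChar_sq (N : ℕ) [NeZero N] :
    ∑ a : ZMod N, stdAddChar (a ^ 2) = √N * ((1 + (-I) ^ N) * (1 + I) / 2) := by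
  have hN : (N : ℂ) ≠ 0 := NeZero.ne _
  have hNr : (0 : ℝ) < N := by exact_mod_cast NeZero.pos N
  set v : ℝ → ℂ := fun t => (N ^ 2 / 4) * (1 + I * (N * t / 2))⁻¹ with hv
  set w : ℝ → ℂ := fun t => t * v t with hw
  have hne (t : ℝ) : 1 + I * (N * t / 2 : ℂ) ≠ 0 := by
    intro h
    have := congr_arg re h
    rw [show (N * t / 2 : ℂ) = ((N * t / 2 : ℝ) : ℂ) by push_cast; rfl] at this
    simp at this
  have hvne (t : ℝ) : v t ≠ 0 :=
    mul_ne_zero (div_ne_zero (pow_ne_zero 2 hN) (by norm_num)) (inv_ne_zero (hne t))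
  have hwre {t : ℝ} (ht : 0 < t) : ((w t)⁻¹).re = t⁻¹ * (4 / N ^ 2) := by
    have : (w t)⁻¹ = ((t⁻¹ * (4 / N ^ 2) : ℝ) : ℂ) + ((2 / N : ℝ) : ℂ) * I := by
      have : (t : ℂ) ≠ 0 := by exact_mod_cast ht.ne'
      have := hne t
      simp only [hw, hv]
      push_cast
      field_simp
      ring
    rw [this, add_re, ofReal_re, re_ofReal_mul, I_re, mul_zero, add_zero]
  have hwpos {t : ℝ} (ht : 0 < t) : 0 < (w t).re := by
    have h1 : 0 < ((w t)⁻¹).re := by rw [hwre ht]; positivity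
    rw [inv_re] at h1
    by_contra! h
    exact h1.not_ge (div_nonpos_of_nonpos_of_nonneg h (normSq_nonneg _))
  have l1 := tendsto_periodic_gaussian (fun a : ZMod N => ZMod.stdAddChar (a ^ 2))
    (l := 𝓝[>] (0 : ℝ))
    (z := fun t : ℝ => (t : ℂ)) (by filter_upwards [self_mem_nhdsWithin] with t ht using ht)
    (by simpa only [← ofReal_inv, ofReal_re] using tendsto_inv_nhdsGT_zero)
  have l2 := tendsto_periodic_gaussian (fun a : ZMod 2 => if a = 0 then 1 else (-I) ^ N)
    (l := 𝓝[>] (0 : ℝ)) (z := w)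
    (by filter_upwards [self_mem_nhdsWithin] with t ht using hwpos ht)
    (by
      refine (tendsto_inv_nhdsGT_zero.atTop_mul_const
        (show (0 : ℝ) < 4 / N ^ 2 by positivity)).congr' ?_
      filter_upwards [self_mem_nhdsWithin] with t ht using (hwre ht).symm)
  simp only [← jacobiTheta₂_zero_rational_add] at l1
  simp only [← jacobiTheta₂_zero_neg_half_add] at l2
  have hs2 : ∑ a : ZMod 2, (if a = 0 then 1 else (-I) ^ N) = 1 + (-I) ^ N := by
    change ∑ a : Fin 2, _ = _
    rw [Fin.sum_univ_two]
    rfl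
  rw [hs2] at l2
  set u : ℝ → ℂ := fun t => ((2 / N : ℝ) : ℂ) * (-I) + t with hu
  have hu0 : (((2 / N : ℝ) : ℂ) * (-I)) ^ (1 / 2 : ℂ) = (1 - I) / √N := by
    have hs : (√N : ℂ) ^ 2 = N := by
      rw [← ofReal_pow, Real.sq_sqrt hNr.le, ofReal_natCast]
    rw [show ((2 / N : ℝ) : ℂ) * (-I) = ((1 - I) / √N) ^ 2 by
      rw [div_pow, hs]; push_cast; field_simp; linear_combination -I_sq, one_div]
    refine sq_cpow_two_inv ?_
    rw [div_ofReal_re]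
    simp
    exact_mod_cast NeZero.pos N
  have hulim : Tendsto (fun t => u t ^ (1 / 2 : ℂ)) (𝓝[>] (0 : ℝ)) (𝓝 ((1 - I) / √N)) := by
    have hc : Continuous u := by fun_prop
    rw [← hu0]
    refine (Tendsto.comp (continuousAt_cpow_const ?_) ((hc.tendsto' 0 _ (by simp [hu])).mono_left
      nhdsWithin_le_nhds))
    right
    rw [im_ofReal_mul]
    simp
    exact (NeZero.ne N)
  have hv0 : ((N : ℂ) ^ 2 / 4) ^ (1 / 2 : ℂ) = N / 2 := by
    rw [show ((N : ℂ) ^ 2 / 4) = (N / 2) ^ 2 by ring, one_div]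
    refine sq_cpow_two_inv ?_
    simp [NeZero.pos N]
  have hvlim : Tendsto (fun t => v t ^ (1 / 2 : ℂ)) (𝓝[>] (0 : ℝ)) (𝓝 (N / 2)) := by
    have hc : Continuous v := by
      refine continuous_const.mul (Continuous.inv₀ (by fun_prop) hne)
    rw [← hv0]
    refine (Tendsto.comp (continuousAt_cpow_const ?_) ((hc.tendsto' 0 _ (by simp [hv])).mono_left
      nhdsWithin_le_nhds))
    left
    rw [show ((N : ℂ) ^ 2 / 4) = ((N ^ 2 / 4 : ℝ) : ℂ) by push_cast; rfl, ofReal_re]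
    positivity
  have hNs : (√N : ℂ) ≠ 0 := by exact_mod_cast (Real.sqrt_pos.2 hNr).ne'
  have h1I : (1 - I) ≠ 0 := by
    intro h; have := congr_arg re h; simp at this
  have l3 := ((tendsto_const_nhds (x := (N / 2 : ℂ))).div (hulim.mul hvlim)
    (mul_ne_zero (div_ne_zero h1I hNs) (div_ne_zero hN two_ne_zero))).mul l2
  have l4 := l3.congr'
      (f₂ := fun t : ℝ => N * (t : ℂ) ^ (1 / 2 : ℂ) * jacobiTheta₂ 0 (2 / N + I * t)) (by
    filter_upwards [self_mem_nhdsWithin] with t ht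
    have ht0 : 0 < t := ht
    have ht' : (t : ℂ) ≠ 0 := by exact_mod_cast ht0.ne'
    have hvv : v t ^ (1 / 2 : ℂ) ≠ 0 := by simp [cpow_eq_zero_iff, hvne t]
    have hτ : (2 / N + I * t : ℂ) ≠ 0 := by
      intro h
      have := congr_arg im h
      rw [show (2 / N : ℂ) = ((2 / N : ℝ) : ℂ) by push_cast; rfl] at this
      simp [ht0.ne'] at this
    have hue : -I * (2 / N + I * t) = u t := by
      simp only [hu]; push_cast; linear_combination -t * I_sq
    have hu0 : u t ≠ 0 := by
      rw [← hue]; exact mul_ne_zero (neg_ne_zero.2 I_ne_zero) hτ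
    have huu : u t ^ (1 / 2 : ℂ) ≠ 0 := by simp [cpow_eq_zero_iff, hu0]
    have hinv : -1 / (2 / N + I * t : ℂ) = -(N / 2) + I * w t := by
      have h := mul_inv_cancel₀ (hne t)
      simp only [hw, hv]
      rw [div_eq_iff hτ]
      generalize (1 + I * (N * t / 2 : ℂ))⁻¹ = X at h
      field_simp
      linear_combination (-4 * I * t * N) * h
    rw [jacobiTheta₂_functional_equation 0 (2 / N + I * t), hinv, hue]
    simp only [hw, ofReal_mul_cpow ht0 (hvne t)]
    simp
    field_simp)
  rw [tendsto_nhds_unique l1 l4]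
  field_simp
  linear_combination (1 + (-I) ^ N) * I_sq

end

section

open Finset Filter Topology MeasureTheory Complex

lemma norm_sum_range_mul_le_of_antitone {a : ℕ → ℂ} {B : ℝ}
    (hB : ∀ n, ‖∑ k ∈ range n, a k‖ ≤ B) {w : ℕ → ℝ} (hw : Antitone w) (hw0 : ∀ n, 0 ≤ w n)
    (n : ℕ) : ‖∑ k ∈ range n, a k * w k‖ ≤ B * w 0 := by
  have key (n : ℕ) : ‖∑ k ∈ range n, a k * w k - (∑ k ∈ range n, a k) * w n‖ ≤
      B * (w 0 - w n) := by
    induction n with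
    | zero => simp
    | succ n ih =>
      have h : ∑ k ∈ range (n + 1), a k * w k - (∑ k ∈ range (n + 1), a k) * w (n + 1) =
          (∑ k ∈ range n, a k * w k - (∑ k ∈ range n, a k) * w n) +
          (∑ k ∈ range (n + 1), a k) * ((w n - w (n + 1) : ℝ) : ℂ) := by
        push_cast
        rw [sum_range_succ, sum_range_succ a]
        ring
      rw [h]
      refine (norm_add_le _ _).trans ?_
      rw [norm_mul, norm_real, Real.norm_of_nonneg (sub_nonneg.2 (hw n.le_succ))]
      have := mul_le_mul_of_nonneg_right (hB (n + 1)) (sub_nonneg.2 (hw n.le_succ))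
      linarith
  have h1 := key n
  have h2 : ‖(∑ k ∈ range n, a k) * (w n : ℂ)‖ ≤ B * w n := by
    rw [norm_mul, norm_real, Real.norm_of_nonneg (hw0 n)]
    exact mul_le_mul_of_nonneg_right (hB n) (hw0 n)
  have h3 := norm_add_le (∑ k ∈ range n, a k * w k - (∑ k ∈ range n, a k) * w n)
    ((∑ k ∈ range n, a k) * (w n : ℂ))
  rw [sub_add_cancel] at h3
  linarith

lemma Function.Periodic.exists_norm_le {D : ℕ → ℂ} {N : ℕ} [NeZero N] (hD : Function.Periodic D N) :
    ∃ B, ∀ n, ‖D n‖ ≤ B := by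
  refine ⟨∑ k ∈ range N, ‖D k‖, fun n => ?_⟩
  rw [← hD.map_mod_nat]
  exact single_le_sum (f := fun k => ‖D k‖) (fun _ _ => norm_nonneg _)
    (mem_range.2 (Nat.mod_lt _ (NeZero.pos N)))

namespace DirichletCharacter

variable {N : ℕ} [NeZero N]

lemma partialSum_natCast_add_level {χ : DirichletCharacter ℂ N} (hχ : χ ≠ 1) (n : ℕ) :
    partialSum χ ((n + N : ℕ) : ℝ) = partialSum χ (n : ℝ) := by
  simp only [partialSum, Nat.floor_natCast]
  have h (n : ℕ) : ∑ k ∈ Icc 1 n, χ (k : ZMod N) =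
      ∑ k ∈ range (n + 1), χ (k : ZMod N) - χ (0 : ZMod N) := by
    rw [sum_range_succ', Nat.cast_zero, add_sub_cancel_right,
      range_eq_Ico, sum_Ico_add' (fun k : ℕ => χ (k : ZMod N)) 0 n 1]
    rfl
  rw [h, h, show n + N + 1 = N + (n + 1) by ring, sum_range_add, sum_range_level_eq_zero hχ]
  simp

lemma sum_range_partialSum {χ : DirichletCharacter ℂ N} (hχ : χ ≠ 1) :
    ∑ n ∈ range N, partialSum χ ((n + 1 : ℕ) : ℝ) = - ∑ j ∈ range N, (j : ℂ) * χ (j : ZMod N) := by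
  have key (M : ℕ) : ∑ n ∈ range M, partialSum χ ((n + 1 : ℕ) : ℝ) =
      (M + 1) * partialSum χ (M : ℝ) - ∑ j ∈ range (M + 1), (j : ℂ) * χ (j : ZMod N) := by
    induction M with
    | zero => simp [partialSum]
    | succ M ih =>
      have h : partialSum χ ((M + 1 : ℕ) : ℝ) =
          partialSum χ (M : ℝ) + χ ((M + 1 : ℕ) : ZMod N) := by
        simp only [partialSum, Nat.floor_natCast]
        rw [sum_Icc_succ_top (by simp)]
      rw [sum_range_succ, ih, sum_range_succ _ (M + 1), h]
      push_cast
      ring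
  have h0 : partialSum χ (N : ℝ) = 0 := by
    have := partialSum_natCast_add_level hχ 0
    simp only [zero_add] at this
    rw [this]
    simp [partialSum]
  rw [key, h0, sum_range_succ]
  have hN : (N : ℂ) * χ (N : ZMod N) = 0 := by
    rw [ZMod.natCast_self]
    rcases eq_or_ne N 1 with rfl | h1
    · exact absurd (level_one χ) hχ
    · have : Nontrivial (ZMod N) := ZMod.nontrivial_iff.2 h1
      rw [χ.map_zero, mul_zero]
  rw [hN]
  ring

theorem LFunction_apply_zero_eq_sum {χ : DirichletCharacter ℂ N} (hχ : χ ≠ 1) :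
    LFunction χ 0 = - (∑ j ∈ range N, (j : ℂ) * χ (j : ZMod N)) / N := by
  set m : ℂ := - (∑ j ∈ range N, (j : ℂ) * χ (j : ZMod N)) / N with hm
  have hN0 : (N : ℂ) ≠ 0 := NeZero.ne _
  set a : ℕ → ℂ := fun n => partialSum χ ((n + 1 : ℕ) : ℝ) - m with ha
  have hasum : ∑ k ∈ range N, a k = 0 := by
    simp only [ha]
    rw [sum_sub_distrib, sum_range_partialSum hχ]
    simp only [hm, sum_const, card_range, nsmul_eq_mul]
    field_simp
    ring
  have hper : Function.Periodic (fun n => ∑ k ∈ range n, a k) N := by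
    intro n
    simp only
    rw [add_comm n N, sum_range_add, hasum, zero_add]
    refine sum_congr rfl fun k _ => ?_
    simp only [ha]
    rw [show N + k + 1 = (k + 1) + N by ring, partialSum_natCast_add_level hχ]
  obtain ⟨B, hB⟩ := hper.exists_norm_le
  have hbound (s : ℝ) (hs : 0 < s) : ‖LFunction χ s - m‖ ≤ s * B := by
    set f : ℝ → ℂ := fun t => (partialSum χ t - m) * (t : ℂ) ^ (-((s : ℂ) + 1)) with hf
    have hpow (t : ℝ) (ht : 0 < t) : (t : ℂ) ^ (-((s : ℂ) + 1)) = ((t ^ (-(s + 1)) : ℝ) : ℂ) := by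
      rw [ofReal_cpow ht.le]; push_cast; rfl
    have hpowint : IntegrableOn (fun t : ℝ => (t : ℂ) ^ (-((s : ℂ) + 1))) (Set.Ioi 1) := by
      refine integrableOn_Ioi_cpow_of_lt ?_ one_pos
      simp; linarith
    have hSint : IntegrableOn (fun t : ℝ => partialSum χ t * (t : ℂ) ^ (-((s : ℂ) + 1)))
        (Set.Ioi 1) := by
      refine hpowint.bdd_mul (c := 2 * N) (measurable_partialSum χ).aestronglyMeasurable ?_
      exact Eventually.of_forall fun t => norm_partialSum_le_level hχ t
    have hfint : IntegrableOn f (Set.Ioi 1) := by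
      have := hSint.sub (hpowint.const_mul m)
      refine this.congr (Eventually.of_forall fun t => ?_)
      simp [hf, sub_mul]
    have hL : LFunction χ s - m = s * ∫ t in Set.Ioi (1 : ℝ), f t := by
      have h1 : ∫ t in Set.Ioi (1 : ℝ), f t =
          (∫ t in Set.Ioi (1 : ℝ), partialSum χ t * (t : ℂ) ^ (-((s : ℂ) + 1))) - m * (1 / s) := by
        simp only [hf, sub_mul]
        rw [integral_sub hSint (hpowint.const_mul m), integral_const_mul,
          integral_Ioi_cpow_of_lt (by simp; linarith) one_pos]
        simp
      rw [h1, LFunction_eq_mul_integral hχ (by simpa using hs)]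
      have : (s : ℂ) ≠ 0 := by exact_mod_cast hs.ne'
      field_simp
    set w : ℕ → ℝ := fun n => ∫ t in (0 : ℝ)..1, (t + (n + 1)) ^ (-(s + 1)) with hw
    have hcont (n : ℕ) : ContinuousOn (fun t : ℝ => (t + (n + 1)) ^ (-(s + 1))) (Set.Icc 0 1) := by
      refine ContinuousOn.rpow_const (by fun_prop) fun t ht => Or.inl ?_
      have := ht.1
      positivity
    have hii (n : ℕ) : IntervalIntegrable (fun t : ℝ => (t + (n + 1)) ^ (-(s + 1))) volume 0 1 :=
      ContinuousOn.intervalIntegrable_of_Icc zero_le_one (hcont n)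
    have hw0 (n : ℕ) : 0 ≤ w n := by
      refine intervalIntegral.integral_nonneg zero_le_one fun t ht => ?_
      have := ht.1
      positivity
    have hwanti : Antitone w := by
      refine antitone_nat_of_succ_le fun n => ?_
      refine intervalIntegral.integral_mono_on zero_le_one (hii _) (hii _) fun t ht => ?_
      have := ht.1
      refine Real.rpow_le_rpow_of_nonpos (by positivity) ?_ (by linarith)
      push_cast; linarith
    have hw1 : w 0 ≤ 1 := by
      have : w 0 ≤ ∫ t in (0 : ℝ)..1, (1 : ℝ) := by
        refine intervalIntegral.integral_mono_on zero_le_one (hii _) (by simp) fun t ht => ?_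
        refine Real.rpow_le_one_of_one_le_of_nonpos ?_ (by linarith)
        have := ht.1
        simp [this]
      simpa using this
    have hpiece (n : ℕ) : ∫ t in ((n : ℝ) + 1)..((n + 1 : ℕ) : ℝ) + 1, f t = a n * w n := by
      have h1 : ∫ t in ((n : ℝ) + 1)..((n + 1 : ℕ) : ℝ) + 1, f t =
          ∫ t in (0 : ℝ)..1, f (t + (n + 1)) := by
        rw [intervalIntegral.integral_comp_add_right]
        congr 1 <;> push_cast <;> ring
      rw [h1, hw]
      simp only
      rw [← intervalIntegral.integral_ofReal, ← intervalIntegral.integral_const_mul]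
      refine intervalIntegral.integral_congr_ae ?_
      have hne : ∀ᵐ t : ℝ, t ≠ 1 := by simp [ae_iff, measure_singleton]
      filter_upwards [hne] with t ht1 ht
      rw [Set.uIoc_of_le zero_le_one] at ht
      have htpos : 0 < t + (n + 1) := by linarith [ht.1, (Nat.cast_nonneg n : (0 : ℝ) ≤ n)]
      have hfl : ⌊t + ((n : ℝ) + 1)⌋₊ = n + 1 := by
        rw [Nat.floor_eq_iff htpos.le]
        push_cast
        constructor
        · linarith [ht.1]
        · linarith [lt_of_le_of_ne ht.2 ht1]
      simp only [hf, ha]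
      rw [hpow _ htpos]
      congr 2
      simp only [partialSum, hfl, Nat.floor_natCast]
    have htend := intervalIntegral_tendsto_integral_Ioi (1 : ℝ) hfint
      (tendsto_atTop_add_const_right atTop (1 : ℝ) (tendsto_natCast_atTop_atTop (R := ℝ)))
    have hsum (M : ℕ) : ∫ t in (1 : ℝ)..(M : ℝ) + 1, f t = ∑ k ∈ range M, a k * w k := by
      have := intervalIntegral.sum_integral_adjacent_intervals (f := f) (μ := volume)
        (a := fun k : ℕ => (k : ℝ) + 1) (n := M) ?_
      · simp only [Nat.cast_zero, zero_add] at this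
        rw [← this]
        exact sum_congr rfl fun k _ => hpiece k
      · intro k _
        rw [intervalIntegrable_iff_integrableOn_Ioc_of_le (by simp)]
        refine hfint.mono_set fun t ht => ?_
        have h1 := ht.1
        have : (0 : ℝ) ≤ k := Nat.cast_nonneg k
        simp only [Set.mem_Ioi]
        linarith
    have hle : ‖∫ t in Set.Ioi (1 : ℝ), f t‖ ≤ B := by
      refine le_of_tendsto htend.norm (Eventually.of_forall fun M => ?_)
      rw [hsum]
      refine (norm_sum_range_mul_le_of_antitone hB hwanti hw0 M).trans ?_
      have hB0 : 0 ≤ B := (norm_nonneg _).trans (hB 0)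
      exact mul_le_of_le_one_right hB0 hw1
    rw [hL, norm_mul, norm_real, Real.norm_of_nonneg hs.le]
    exact mul_le_mul_of_nonneg_left hle hs.le
  have h1 : Tendsto (fun s : ℝ => ‖LFunction χ s - m‖) (𝓝[>] 0) (𝓝 ‖LFunction χ 0 - m‖) := by
    have hc : Continuous fun s : ℝ => ‖LFunction χ s - m‖ :=
      (((differentiable_LFunction hχ).continuous.comp continuous_ofReal).sub
        continuous_const).norm
    simpa using (hc.tendsto 0).mono_left nhdsWithin_le_nhds
  have h2 : Tendsto (fun s : ℝ => s * B) (𝓝[>] 0) (𝓝 0) := by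
    have hc : Continuous fun s : ℝ => s * B := by fun_prop
    simpa using (hc.tendsto 0).mono_left nhdsWithin_le_nhds
  have h3 := le_of_tendsto_of_tendsto h1 h2
    (eventually_nhdsWithin_of_forall fun s hs => hbound s hs)
  exact sub_eq_zero.1 (norm_le_zero_iff.1 h3)

end DirichletCharacter

end

section

open Finset Filter Topology Complex
open scoped Real

namespace DirichletCharacter

theorem IsPrimitive.LFunction_apply_zero_of_odd {N : ℕ} [NeZero N] {ψ : DirichletCharacter ℂ N}
    (hψ : ψ.IsPrimitive) (hsq : ψ ^ 2 = 1) (hodd : ψ.Odd) :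
    LFunction ψ 0 = -I * gaussSum ψ ZMod.stdAddChar * LFunction ψ 1 / π := by
  have hinv : ψ⁻¹ = ψ := inv_eq_of_mul_eq_one_right (by rwa [← sq])
  have hodd' : ∀ a, ψ (-a) = - ψ a := hodd.eval_neg
  have h0 : ψ 0 = 0 := by
    have := hodd' 0
    rw [neg_zero] at this
    exact self_eq_neg.1 this
  set G := gaussSum ψ ZMod.stdAddChar with hG
  have hF : ZMod.dft (ψ : ZMod N → ℂ) = fun k => -G * ψ k := by
    funext k
    rw [hψ.fourierTransform_eq_inv_mul_gaussSum, hinv, hodd']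
    ring
  have hF' : ZMod.dft (fun x => ψ (-x)) = fun k => G * ψ k := by
    have : (fun x => ψ (-x)) = fun x => (-1 : ℂ) • ψ x := by
      funext x
      rw [hodd']
      simp
    rw [this, ← Pi.smul_def, ZMod.dft_const_smul]
    funext k
    rw [Pi.smul_apply, hF]
    simp
  have key := ZMod.LFunction_one_sub (ψ : ZMod N → ℂ) (s := 1) ?_ (Or.inl h0)
  · have hmul (c : ℂ) : ZMod.LFunction (fun k => c * ψ k) 1 = c * LFunction ψ 1 := by
      simp only [ZMod.LFunction, LFunction, mul_sum]
      refine sum_congr rfl fun _ _ => by ring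
    rw [hF, hF', hmul, hmul] at key
    have e1 : cexp (π * I * 1 / 2) = I := by
      rw [mul_one, mul_div_right_comm, exp_pi_div_two_mul_I]
    have e2 : cexp (-π * I * 1 / 2) = -I := by
      rw [mul_one, mul_div_right_comm, exp_neg_pi_div_two_mul_I]
    rw [e1, e2, sub_self, Gamma_one, cpow_zero, cpow_neg_one] at key
    rw [LFunction, key]
    have : (π : ℂ) ≠ 0 := by exact_mod_cast Real.pi_ne_zero
    field_simp
    ring
  · intro n h
    have := congrArg re h
    simp at this
    have h2 : (0 : ℝ) ≤ n := Nat.cast_nonneg n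
    linarith

end DirichletCharacter

/-- The quadratic character modulo an odd prime, as a complex Dirichlet character. -/
noncomputable def quadDirichlet (p : ℕ) [Fact p.Prime] : DirichletCharacter ℂ p :=
  (quadraticChar (ZMod p)).ringHomComp (Int.castRingHom ℂ)

section

variable {p : ℕ} [Fact p.Prime]

lemma quadDirichlet_apply (a : ZMod p) : quadDirichlet p a = (quadraticChar (ZMod p) a : ℂ) := rfl

lemma ringChar_zmod_ne_two (hp : p ≠ 2) : ringChar (ZMod p) ≠ 2 := by
  rwa [ZMod.ringChar_zmod_n]

lemma quadDirichlet_ne_one (hp : p ≠ 2) : quadDirichlet p ≠ 1 := by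
  intro h
  obtain ⟨a, ha⟩ := quadraticChar_exists_neg_one (ringChar_zmod_ne_two hp)
  have ha0 : IsUnit a := by
    rw [isUnit_iff_ne_zero]
    rintro rfl
    simp at ha
  have := congrArg (fun χ : DirichletCharacter ℂ p => χ a) h
  simp only [quadDirichlet_apply, ha, MulChar.one_apply ha0] at this
  norm_num at this

lemma quadDirichlet_sq : quadDirichlet p ^ 2 = 1 := by
  refine MulChar.ext fun a => ?_
  rw [MulChar.pow_apply_coe, quadDirichlet_apply, MulChar.one_apply_coe]
  have := quadraticChar_sq_one a.ne_zero
  exact_mod_cast this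

lemma isPrimitive_quadDirichlet (hp : p ≠ 2) : (quadDirichlet p).IsPrimitive := by
  have hpp : p.Prime := Fact.out
  rw [DirichletCharacter.isPrimitive_def]
  rcases (Nat.dvd_prime hpp).1 (DirichletCharacter.conductor_dvd_level (quadDirichlet p)) with h | h
  · exact absurd ((DirichletCharacter.eq_one_iff_conductor_eq_one).2 h) (quadDirichlet_ne_one hp)
  · exact h

lemma gaussSum_quadDirichlet (hp : p ≠ 2) :
    gaussSum (quadDirichlet p) ZMod.stdAddChar = √p * ((1 + (-I) ^ p) * (1 + I) / 2) := by
  rw [← ZMod.sum_stdAddChar_sq]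
  have h1 : ∑ a : ZMod p, ZMod.stdAddChar (a ^ 2) =
      ∑ b : ZMod p, ((quadraticChar (ZMod p) b + 1 : ℤ) : ℂ) * ZMod.stdAddChar b := by
    rw [← sum_fiberwise_of_maps_to (t := univ) (g := fun a : ZMod p => a ^ 2) (by simp)]
    refine sum_congr rfl fun b _ => ?_
    rw [← quadraticChar_card_sqrts (ringChar_zmod_ne_two hp)]
    have : ∀ a ∈ univ.filter fun a : ZMod p => a ^ 2 = b,
        (ZMod.stdAddChar (a ^ 2) : ℂ) = ZMod.stdAddChar b := by
      intro a ha
      rw [(mem_filter.1 ha).2]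
    rw [sum_congr rfl this, sum_const, nsmul_eq_mul]
    congr 1
    norm_cast
    congr 1
    ext
    simp
  have h2 : ∑ b : ZMod p, (ZMod.stdAddChar b : ℂ) = 0 :=
    by
    refine AddChar.sum_eq_zero_of_ne_one fun h => ?_
    have := ZMod.isPrimitive_stdAddChar p one_ne_zero
    rw [AddChar.mulShift_one] at this
    exact this h
  rw [h1, gaussSum]
  push_cast
  simp only [add_mul, one_mul, sum_add_distrib, h2, add_zero]
  rfl

lemma gaussSum_quadDirichlet_of_mod_four_eq_one (h : p % 4 = 1) :
    gaussSum (quadDirichlet p) ZMod.stdAddChar = √p := by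
  rw [gaussSum_quadDirichlet (by rintro rfl; simp at h)]
  have : (-I) ^ p = -I := by
    rw [← Nat.div_add_mod p 4, h, pow_add, pow_mul]
    rw [show (-I) ^ 4 = 1 by rw [neg_pow, I_pow_four]; norm_num, one_pow, one_mul, pow_one]
  rw [this]
  ring_nf
  rw [I_sq]
  ring

lemma gaussSum_quadDirichlet_of_mod_four_eq_three (h : p % 4 = 3) :
    gaussSum (quadDirichlet p) ZMod.stdAddChar = I * √p := by
  rw [gaussSum_quadDirichlet (by rintro rfl; simp at h)]
  have : (-I) ^ p = I := by
    rw [← Nat.div_add_mod p 4, h, pow_add, pow_mul]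
    rw [show (-I) ^ 4 = 1 by rw [neg_pow, I_pow_four]; norm_num, one_pow, one_mul, neg_pow,
      I_pow_three]
    norm_num
  rw [this]
  ring_nf
  rw [I_sq]
  ring

lemma even_quadDirichlet_of_mod_four_eq_one (h : p % 4 = 1) : (quadDirichlet p).Even := by
  rw [DirichletCharacter.Even, quadDirichlet_apply,
    quadraticChar_neg_one (ringChar_zmod_ne_two (by rintro rfl; simp at h)), ZMod.card,
    ZMod.χ₄_nat_one_mod_four h]
  simp

lemma odd_quadDirichlet_of_mod_four_eq_three (h : p % 4 = 3) : (quadDirichlet p).Odd := by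
  rw [DirichletCharacter.Odd, quadDirichlet_apply,
    quadraticChar_neg_one (ringChar_zmod_ne_two (by rintro rfl; simp at h)), ZMod.card,
    ZMod.χ₄_nat_three_mod_four h]
  simp

end

end

section

open Finset Filter Topology Complex
open scoped Real

namespace DirichletCharacter

variable {q₁ q₂ : ℕ} [NeZero q₁] [NeZero q₂]

lemma IsPrimitive.changeLevel_mul_changeLevel {χ : DirichletCharacter ℂ q₁}
    {ψ : DirichletCharacter ℂ q₂} (hχ : χ.IsPrimitive) (hψ : ψ.IsPrimitive)
    (h : q₁.Coprime q₂) :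
    (changeLevel (Dvd.intro _ rfl) χ * changeLevel (Dvd.intro_left _ rfl) ψ :
      DirichletCharacter ℂ (q₁ * q₂)).IsPrimitive := by
  set χ' : DirichletCharacter ℂ (q₁ * q₂) := changeLevel (Dvd.intro _ rfl) χ with hχ'
  set ψ' : DirichletCharacter ℂ (q₁ * q₂) := changeLevel (Dvd.intro_left _ rfl) ψ with hψ'
  have c1 : χ'.conductor = q₁ := by rw [hχ', conductor_changeLevel]; exact hχ
  have c2 : ψ'.conductor = q₂ := by rw [hψ', conductor_changeLevel]; exact hψ
  rw [isPrimitive_def]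
  refine Nat.dvd_antisymm (conductor_dvd_level _) ?_
  refine h.mul_dvd_of_dvd_of_dvd ?_ ?_
  · have := conductor_mul_dvd_lcm_conductor (χ' * ψ') ψ'⁻¹
    rw [mul_inv_cancel_right, conductor_inv, c1, c2] at this
    exact h.dvd_of_dvd_mul_right (this.trans (Nat.lcm_dvd_mul _ _))
  · have := conductor_mul_dvd_lcm_conductor (χ' * ψ') χ'⁻¹
    rw [mul_comm χ', mul_inv_cancel_right, conductor_inv, c1, c2] at this
    rw [mul_comm χ']
    exact h.symm.dvd_of_dvd_mul_right (this.trans (Nat.lcm_dvd_mul _ _))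

lemma gaussSum_changeLevel_mul_changeLevel (χ : DirichletCharacter ℂ q₁)
    (ψ : DirichletCharacter ℂ q₂) (h : q₁.Coprime q₂) :
    gaussSum (changeLevel (Dvd.intro _ rfl) χ * changeLevel (Dvd.intro_left _ rfl) ψ :
      DirichletCharacter ℂ (q₁ * q₂)) ZMod.stdAddChar =
    χ q₂ * ψ q₁ * (gaussSum χ ZMod.stdAddChar * gaussSum ψ ZMod.stdAddChar) := by
  set f : ZMod q₁ × ZMod q₂ → ZMod (q₁ * q₂) :=
    fun x => ((x.1.val * q₂ + x.2.val * q₁ : ℕ) : ZMod (q₁ * q₂)) with hf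
  have hbij : Function.Bijective f := by
    rw [Fintype.bijective_iff_injective_and_card]
    refine ⟨?_, by simp [ZMod.card]⟩
    rintro ⟨a, b⟩ ⟨a', b'⟩ hab
    simp only [hf] at hab
    rw [ZMod.natCast_eq_natCast_iff] at hab
    have e1 := (ZMod.natCast_eq_natCast_iff _ _ q₁).2 (hab.of_mul_right q₂)
    have e2 := (ZMod.natCast_eq_natCast_iff _ _ q₂).2 (hab.of_mul_left q₁)
    push_cast at e1 e2
    simp only [ZMod.natCast_zmod_val, ZMod.natCast_self, mul_zero, add_zero, zero_add] at e1 e2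
    have u1 : IsUnit (q₂ : ZMod q₁) := (ZMod.isUnit_iff_coprime _ _).2 h.symm
    have u2 : IsUnit (q₁ : ZMod q₂) := (ZMod.isUnit_iff_coprime _ _).2 h
    exact Prod.ext (u1.mul_right_cancel e1) (u2.mul_right_cancel e2)
  have hadd (a : ZMod q₁) (b : ZMod q₂) : (ZMod.stdAddChar (f (a, b)) : ℂ) =
      ZMod.stdAddChar a * ZMod.stdAddChar b := by
    have h1 : f (a, b) = ((a.val * q₂ + b.val * q₁ : ℤ) : ZMod (q₁ * q₂)) := by
      simp [hf]
    have ha : a = ((a.val : ℤ) : ZMod q₁) := by simp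
    have hb : b = ((b.val : ℤ) : ZMod q₂) := by simp
    rw [h1, ZMod.stdAddChar_coe]
    conv_rhs => rw [ha, hb]
    rw [ZMod.stdAddChar_coe, ZMod.stdAddChar_coe, ← Complex.exp_add]
    congr 1
    have n1 : (q₁ : ℂ) ≠ 0 := NeZero.ne _
    have n2 : (q₂ : ℂ) ≠ 0 := NeZero.ne _
    push_cast
    field_simp
  rw [gaussSum, ← hbij.sum_comp, Fintype.sum_prod_type, gaussSum, gaussSum, sum_mul_sum, mul_sum]
  refine sum_congr rfl fun a _ => ?_
  rw [mul_sum]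
  refine sum_congr rfl fun b _ => ?_
  rw [hadd]
  simp only [hf]
  rw [changeLevel_mul_changeLevel_natCast]
  push_cast
  simp only [ZMod.natCast_zmod_val, ZMod.natCast_self, mul_zero, add_zero, zero_add, map_mul]
  ring

end DirichletCharacter

lemma quadDirichlet_three {p : ℕ} [Fact p.Prime] (hp : p % 12 = 1 ∨ p % 12 = 11) :
    quadDirichlet p 3 = 1 := by
  have key := quadraticChar_odd_prime (F := ZMod p)
    (ringChar_zmod_ne_two (by rintro rfl; simp at hp)) (p := 3) (by norm_num)
    (by rw [ZMod.ringChar_zmod_n]; rintro rfl; simp at hp)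
  rw [ZMod.card] at key
  rw [quadDirichlet_apply, show ((3 : ZMod p)) = ((3 : ℕ) : ZMod p) by norm_num, key]
  have hcast : ((p : ℕ) : ZMod 3) = ((p % 3 : ℕ) : ZMod 3) := by simp
  rw [hcast]
  rcases hp with hp | hp
  · rw [ZMod.χ₄_nat_one_mod_four (by omega), show p % 3 = 1 by omega]
    simp
  · rw [ZMod.χ₄_nat_three_mod_four (by omega), show p % 3 = 2 by omega]
    have : (quadraticChar (ZMod 3)) (((-1 : ℤ) : ZMod 3) * ((2 : ℕ) : ZMod 3)) = 1 := by decide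
    rw [this]
    simp

lemma quadDirichlet_three_natCast (n : ℕ) :
    quadDirichlet 3 (n : ZMod 3) = if n % 3 = 0 then 0 else if n % 3 = 1 then 1 else -1 := by
  rw [quadDirichlet_apply]
  have hcast : ((n : ℕ) : ZMod 3) = ((n % 3 : ℕ) : ZMod 3) := by simp
  rw [hcast]
  have hlt := Nat.mod_lt n (show 3 > 0 by norm_num)
  interval_cases n % 3
  · simp
  · simp
  · have : (quadraticChar (ZMod 3)) ((2 : ℕ) : ZMod 3) = -1 := by decide
    rw [this]
    simp

end

section

open Finset Filter Topology Complex
open scoped Real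

/-- The sum of the values of `χ` over the `a` in `[1, p - 1]` with `a ≡ i` modulo `3`. -/
noncomputable def classSumThree {p : ℕ} (χ : DirichletCharacter ℂ p) (i : ℕ) : ℂ :=
  ∑ a ∈ Icc 1 (p - 1) with a % 3 = i, χ (a : ZMod p)

lemma sum_mul_mod_three_eq {p : ℕ} (χ : DirichletCharacter ℂ p) (g : ℕ → ℂ) :
    ∑ a ∈ Icc 1 (p - 1), g (a % 3) * χ (a : ZMod p) =
      g 0 * classSumThree χ 0 + g 1 * classSumThree χ 1 + g 2 * classSumThree χ 2 := by
  rw [← sum_fiberwise_of_maps_to (t := range 3) (g := fun a => a % 3)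
    (fun a _ => mem_range.2 (Nat.mod_lt _ (by norm_num)))]
  have h (i : ℕ) : ∑ a ∈ Icc 1 (p - 1) with a % 3 = i, g (a % 3) * χ (a : ZMod p) =
      g i * classSumThree χ i := by
    rw [classSumThree, mul_sum]
    refine sum_congr rfl fun a ha => ?_
    rw [(mem_filter.1 ha).2]
  simp only [h, sum_range_succ, sum_range_zero, zero_add]

lemma sum_range_eq_sum_Icc {p : ℕ} (hp : 0 < p) {f : ℕ → ℂ} (hf : f 0 = 0) :
    ∑ a ∈ range p, f a = ∑ a ∈ Icc 1 (p - 1), f a := by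
  symm
  refine sum_subset (fun a ha => ?_) fun a ha ha' => ?_
  · simp only [mem_Icc, mem_range] at *
    omega
  · simp only [mem_Icc, mem_range] at *
    rw [show a = 0 by omega, hf]

lemma classSumThree_reflect {p : ℕ} (χ : DirichletCharacter ℂ p) {i j : ℕ} (hi : i < 3)
    (hj : j < 3) (hij : (i + j) % 3 = p % 3) :
    classSumThree χ i = χ (-1) * classSumThree χ j := by
  rw [classSumThree, classSumThree, mul_sum]
  refine sum_nbij' (fun a => p - a) (fun a => p - a) ?_ ?_ ?_ ?_ ?_
  · intro a ha
    simp only [mem_filter, mem_Icc] at *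
    omega
  · intro a ha
    simp only [mem_filter, mem_Icc] at *
    omega
  · intro a ha
    simp only [mem_filter, mem_Icc] at *
    omega
  · intro a ha
    simp only [mem_filter, mem_Icc] at *
    omega
  · intro a ha
    simp only [mem_filter, mem_Icc] at ha
    rw [← map_mul, Nat.cast_sub (by omega)]
    simp

lemma sum_mul_eq_of_mod_three_eq_two {p : ℕ} [Fact p.Prime] {χ : DirichletCharacter ℂ p}
    (hp : p % 3 = 2) (h3 : χ 3 = 1) :
    2 * ∑ a ∈ Icc 1 (p - 1), (a : ℂ) * χ (a : ZMod p) =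
      p * (classSumThree χ 1 + 2 * classSumThree χ 2) := by
  have hbij : ∑ a ∈ Icc 1 (p - 1), ((a : ℂ) + p * (a % 3 : ℕ)) * χ (a : ZMod p) =
      ∑ m ∈ Icc 1 (p - 1), 3 * ((m : ℂ) * χ (m : ZMod p)) := by
    refine sum_nbij' (fun a => (a + p * (a % 3)) / 3) (fun m => 3 * m % p) ?_ ?_ ?_ ?_ ?_
    · intro a ha
      simp only [mem_Icc] at *
      have h : a % 3 = 0 ∨ a % 3 = 1 ∨ a % 3 = 2 := by omega
      rcases h with h | h | h <;> rw [h] <;> omega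
    · intro m hm
      simp only [mem_Icc] at *
      have h : 3 * m % p = 3 * m ∧ 3 * m < p ∨ 3 * m % p = 3 * m - p ∧ p ≤ 3 * m ∧ 3 * m < 2 * p ∨
          3 * m % p = 3 * m - 2 * p ∧ 2 * p ≤ 3 * m := by
        rcases lt_or_ge (3 * m) p with h | h
        · exact Or.inl ⟨Nat.mod_eq_of_lt h, h⟩
        rcases lt_or_ge (3 * m) (2 * p) with h' | h'
        · refine Or.inr (Or.inl ⟨?_, h, h'⟩)
          rw [Nat.mod_eq_sub_mod h, Nat.mod_eq_of_lt (by omega)]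
        · refine Or.inr (Or.inr ⟨?_, h'⟩)
          rw [Nat.mod_eq_sub_mod h, Nat.mod_eq_sub_mod (by omega), Nat.mod_eq_of_lt (by omega)]
          omega
      have hne : 3 * m ≠ p := fun h => by omega
      have hne2 : 3 * m ≠ 2 * p := fun h => by omega
      rcases h with h | h | h <;> omega
    · intro a ha
      simp only [mem_Icc] at *
      have h : a % 3 = 0 ∨ a % 3 = 1 ∨ a % 3 = 2 := by omega
      have h2 : 3 * ((a + p * (a % 3)) / 3) = a + p * (a % 3) := by
        rcases h with h | h | h <;> rw [h] <;> omega
      rw [h2, Nat.add_mul_mod_self_left, Nat.mod_eq_of_lt (by omega)]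
    · intro m hm
      simp only [mem_Icc] at *
      rcases lt_or_ge (3 * m) p with h | h
      · rw [Nat.mod_eq_of_lt h, show 3 * m % 3 = 0 by omega]
        omega
      rcases lt_or_ge (3 * m) (2 * p) with h' | h'
      · rw [Nat.mod_eq_sub_mod h, Nat.mod_eq_of_lt (by omega), show (3 * m - p) % 3 = 1 by omega]
        omega
      · rw [Nat.mod_eq_sub_mod h, Nat.mod_eq_sub_mod (by omega), Nat.mod_eq_of_lt (by omega),
          show (3 * m - p - p) % 3 = 2 by omega]
        omega
    · intro a ha
      have h : a % 3 = 0 ∨ a % 3 = 1 ∨ a % 3 = 2 := by omega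
      have h2 : 3 * ((a + p * (a % 3)) / 3) = a + p * (a % 3) := by
        rcases h with h | h | h <;> rw [h] <;> omega
      have h4 : χ (((a + p * (a % 3)) / 3 : ℕ) : ZMod p) = χ (a : ZMod p) := by
        rw [← one_mul (χ (((a + p * (a % 3)) / 3 : ℕ) : ZMod p)), ← h3, ← map_mul]
        congr 1
        have := congrArg (fun k : ℕ => (k : ZMod p)) h2
        push_cast at this
        simpa using this
      rw [h4, ← mul_assoc]
      congr 1
      have := congrArg (fun k : ℕ => (k : ℂ)) h2
      push_cast at this ⊢
      exact this.symm
  have hg := sum_mul_mod_three_eq χ (fun i => (i : ℂ))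
  simp only [add_mul, sum_add_distrib, mul_assoc, ← mul_sum] at hbij
  rw [hg] at hbij
  push_cast at hbij
  linear_combination -hbij

lemma LFunction_apply_zero_eq_classSumThree {p : ℕ} [Fact p.Prime] {χ : DirichletCharacter ℂ p}
    (hχ : χ ≠ 1) (hodd : χ.Odd) (hp : p % 3 = 2) (h3 : χ 3 = 1) :
    DirichletCharacter.LFunction χ 0 = classSumThree χ 0 := by
  have hpos : 0 < p := (Fact.out : p.Prime).pos
  have hp0 : (p : ℂ) ≠ 0 := by exact_mod_cast hpos.ne'
  have h1 := sum_mul_eq_of_mod_three_eq_two hp h3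
  have h2 := classSumThree_reflect χ (i := 1) (j := 1) (by norm_num) (by norm_num) (by omega)
  have h4 := classSumThree_reflect χ (i := 2) (j := 0) (by norm_num) (by norm_num) (by omega)
  have hodd' : χ (-1) = -1 := hodd
  rw [hodd'] at h2 h4
  rw [DirichletCharacter.LFunction_apply_zero_eq_sum hχ, sum_range_eq_sum_Icc hpos (by simp),
    div_eq_iff hp0]
  linear_combination (-1 / 2 : ℂ) * h1 - (p : ℂ) / 4 * h2 - (p : ℂ) * h4

lemma LFunction_apply_zero_eq_two_mul_classSumThree {p : ℕ} [Fact p.Prime]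
    {χ : DirichletCharacter ℂ p} (hχ : χ ≠ 1) (heven : χ.Even) (hp : p % 3 = 1)
    {ψ : DirichletCharacter ℂ (p * 3)} (hψ1 : ψ ≠ 1)
    (hψ : ∀ n : ℕ, ψ n = χ n * quadDirichlet 3 n) :
    DirichletCharacter.LFunction ψ 0 = 2 * classSumThree χ 0 := by
  have hpos : 0 < p := (Fact.out : p.Prime).pos
  have hp0 : (p : ℂ) ≠ 0 := by exact_mod_cast hpos.ne'
  have hχ0 : χ 0 = 0 := χ.map_zero
  have h4 := classSumThree_reflect χ (i := 1) (j := 0) (by norm_num) (by norm_num) (by omega)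
  have heven' : χ (-1) = 1 := heven
  rw [heven', one_mul] at h4
  have hzero : ∑ a ∈ Icc 1 (p - 1), χ (a : ZMod p) = 0 := by
    rw [← sum_range_eq_sum_Icc hpos (by simp [hχ0]), DirichletCharacter.sum_range_level_eq_zero hχ]
  have h5 := sum_mul_mod_three_eq χ (fun _ => 1)
  simp only [one_mul, hzero] at h5
  set t : ℕ → ℂ := fun n => if n % 3 = 0 then 0 else if n % 3 = 1 then 1 else -1 with ht
  have ht0 (a : ℕ) : t (p + a) = t (1 + a % 3) := by
    have : (p + a) % 3 = (1 + a % 3) % 3 := by omega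
    simp only [ht, this]
  have ht1 (a : ℕ) : t (p + (p + a)) = t (2 + a % 3) := by
    have : (p + (p + a)) % 3 = (2 + a % 3) % 3 := by omega
    simp only [ht, this]
  have ht2 (a : ℕ) : t a = t (a % 3) := by simp only [ht, Nat.mod_mod]
  have hs : ∑ j ∈ range (p * 3), (j : ℂ) * ψ (j : ZMod (p * 3)) =
      ∑ a ∈ range p, (p * (t (1 + a % 3) + 2 * t (2 + a % 3)) +
        a * (t (a % 3) + t (1 + a % 3) + t (2 + a % 3))) * χ (a : ZMod p) := by
    have hψ' (j : ℕ) : (j : ℂ) * ψ (j : ZMod (p * 3)) = j * (χ (j : ZMod p) * t j) := by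
      rw [hψ, quadDirichlet_three_natCast]
    simp only [hψ']
    rw [show p * 3 = p + (p + p) by ring, sum_range_add, sum_range_add, ← sum_add_distrib,
      ← sum_add_distrib]
    refine sum_congr rfl fun a _ => ?_
    rw [ht0, ht1, ht2]
    push_cast
    simp only [ZMod.natCast_self, zero_add]
    ring
  have hs2 : ∑ j ∈ range (p * 3), (j : ℂ) * ψ (j : ZMod (p * 3)) =
      ∑ a ∈ Icc 1 (p - 1), (p * (t (1 + a % 3) + 2 * t (2 + a % 3))) * χ (a : ZMod p) := by
    rw [hs, sum_range_eq_sum_Icc hpos (by simp [hχ0])]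
    refine sum_congr rfl fun a _ => ?_
    have hz : t (a % 3) + t (1 + a % 3) + t (2 + a % 3) = 0 := by
      have h : a % 3 = 0 ∨ a % 3 = 1 ∨ a % 3 = 2 := by omega
      rcases h with h | h | h <;> simp [h, ht]
    rw [hz, mul_zero, add_zero]
  rw [sum_mul_mod_three_eq χ (fun i => p * (t (1 + i) + 2 * t (2 + i)))] at hs2
  rw [DirichletCharacter.LFunction_apply_zero_eq_sum hψ1, hs2,
    div_eq_iff (by exact_mod_cast (by omega : p * 3 ≠ 0))]
  simp [ht]
  linear_combination (3 * p : ℂ) * h4 + (2 * p : ℂ) * h5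

end

section

open Finset Filter Topology Complex
open scoped Real

lemma exists_le_classSumThree {ε : ℝ} (hε : 0 < ε) : ∃ C : ℝ, 0 < C ∧
    ∀ (p : ℕ) [Fact p.Prime], (p % 12 = 1 ∨ p % 12 = 11) →
      C * (p : ℝ) ^ (1 / 2 - ε) ≤ (classSumThree (quadDirichlet p) 0).re := by
  obtain ⟨C, hC, hsiegel⟩ := DirichletCharacter.siegel hε
  have h3 : (0 : ℝ) < 3 ^ (1 / 2 - ε) := by positivity
  refine ⟨min (C / π) (C * 3 ^ (1 / 2 - ε) / (2 * π)), by positivity, fun p _ hp => ?_⟩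
  have hp2 : p ≠ 2 := by rintro rfl; simp at hp
  have hpos : (0 : ℝ) < p := by exact_mod_cast (Fact.out : p.Prime).pos
  have hpow (q : ℝ) (hq : 0 < q) : q ^ (1 / 2 - ε) = √q * q ^ (-ε) := by
    rw [sub_eq_add_neg, Real.rpow_add hq, Real.sqrt_eq_rpow]
  have hpp : 0 < (p : ℝ) ^ (1 / 2 - ε) := by positivity
  rcases hp with hp | hp
  · have hcop : p.Coprime 3 :=
      (Nat.coprime_primes Fact.out Nat.prime_three).2 (by rintro rfl; simp at hp)
    set ψ : DirichletCharacter ℂ (p * 3) :=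
      DirichletCharacter.changeLevel (Dvd.intro _ rfl) (quadDirichlet p) *
        DirichletCharacter.changeLevel (Dvd.intro_left _ rfl) (quadDirichlet 3) with hψ
    have hprim : ψ.IsPrimitive := (isPrimitive_quadDirichlet hp2).changeLevel_mul_changeLevel
      (isPrimitive_quadDirichlet (by norm_num)) hcop
    have hψn (n : ℕ) : ψ n = quadDirichlet p n * quadDirichlet 3 n :=
      DirichletCharacter.changeLevel_mul_changeLevel_natCast _ _ n
    have heven := even_quadDirichlet_of_mod_four_eq_one (p := p) (by omega)
    have hodd3 := odd_quadDirichlet_of_mod_four_eq_three (p := 3) (by norm_num)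
    have hψ1 : ψ ≠ 1 := by
      intro h
      rw [DirichletCharacter.isPrimitive_def, h, DirichletCharacter.conductor_one] at hprim
      omega
    have hsq : ψ ^ 2 = 1 := by
      rw [hψ, mul_pow, ← map_pow, ← map_pow, quadDirichlet_sq, quadDirichlet_sq]
      simp
    have hodd : ψ.Odd := by
      have h1 : (-1 : ZMod (p * 3)) = ((p * 3 - 1 : ℕ) : ZMod (p * 3)) := by
        rw [Nat.cast_sub (by omega), ZMod.natCast_self]
        simp
      rw [DirichletCharacter.Odd, h1, hψn, Nat.cast_sub (by omega), Nat.cast_sub (by omega)]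
      have he : quadDirichlet p (-1) = 1 := heven
      have ho : quadDirichlet 3 (-1) = -1 := hodd3
      have z3 : (3 : ZMod 3) = 0 := rfl
      simp [he, ho, z3]
    have hL := LFunction_apply_zero_eq_two_mul_classSumThree (quadDirichlet_ne_one hp2) heven
      (by omega) hψ1 hψn
    have hp3 : quadDirichlet 3 (p : ZMod 3) = 1 := by
      rw [quadDirichlet_three_natCast, if_neg (by omega), if_pos (by omega)]
    have hG : gaussSum ψ ZMod.stdAddChar = I * (√(p * 3) : ℝ) := by
      rw [hψ, DirichletCharacter.gaussSum_changeLevel_mul_changeLevel _ _ hcop, hp3,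
        gaussSum_quadDirichlet_of_mod_four_eq_one (by omega),
        gaussSum_quadDirichlet_of_mod_four_eq_three (by norm_num), Nat.cast_ofNat,
        quadDirichlet_three (Or.inl hp), Real.sqrt_mul hpos.le]
      push_cast
      ring
    rw [hprim.LFunction_apply_zero_of_odd hsq hodd, hG] at hL
    have hR : classSumThree (quadDirichlet p) 0 =
        ((√(p * 3) / (2 * π) : ℝ) : ℂ) * DirichletCharacter.LFunction ψ 1 := by
      have : (π : ℂ) ≠ 0 := by exact_mod_cast Real.pi_ne_zero
      have h2 : classSumThree (quadDirichlet p) 0 =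
          (2 * classSumThree (quadDirichlet p) 0) / 2 := by
        ring
      rw [h2, ← hL]
      push_cast
      field_simp
      rw [I_sq]
      ring
    rw [hR, re_ofReal_mul]
    have hs := hsiegel (p * 3) ψ hprim hψ1 hsq
    calc min (C / π) (C * 3 ^ (1 / 2 - ε) / (2 * π)) * (p : ℝ) ^ (1 / 2 - ε)
        ≤ (C * 3 ^ (1 / 2 - ε) / (2 * π)) * (p : ℝ) ^ (1 / 2 - ε) := by
          gcongr
          exact min_le_right _ _
      _ = √(p * 3) / (2 * π) * (C * ((p * 3 : ℕ) : ℝ) ^ (-ε)) := by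
          have h := hpow (p * 3) (by positivity)
          rw [Real.mul_rpow hpos.le (by norm_num)] at h
          push_cast
          linear_combination (C / (2 * π)) * h
      _ ≤ _ := by gcongr
  · have hodd := odd_quadDirichlet_of_mod_four_eq_three (p := p) (by omega)
    have hprim := isPrimitive_quadDirichlet hp2
    have hL := LFunction_apply_zero_eq_classSumThree (quadDirichlet_ne_one hp2) hodd
      (by omega) (quadDirichlet_three (Or.inr hp))
    rw [hprim.LFunction_apply_zero_of_odd quadDirichlet_sq hodd,
      gaussSum_quadDirichlet_of_mod_four_eq_three (by omega)] at hL
    have hR : classSumThree (quadDirichlet p) 0 =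
        ((√p / π : ℝ) : ℂ) * DirichletCharacter.LFunction (quadDirichlet p) 1 := by
      rw [← hL]
      push_cast
      field_simp
      rw [I_sq]
      ring
    rw [hR, re_ofReal_mul]
    have hs := hsiegel p _ hprim (quadDirichlet_ne_one hp2) quadDirichlet_sq
    calc min (C / π) (C * 3 ^ (1 / 2 - ε) / (2 * π)) * (p : ℝ) ^ (1 / 2 - ε)
        ≤ (C / π) * (p : ℝ) ^ (1 / 2 - ε) := by
          gcongr
          exact min_le_left _ _
      _ = √p / π * (C * (p : ℝ) ^ (-ε)) := by
          rw [hpow p hpos]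
          ring
      _ ≤ _ := by gcongr

end

section

open Finset Filter Topology Complex
open scoped Real

lemma isQR_iff_isSquare (p a : ℕ) : IsQR p a ↔ IsSquare (a : ZMod p) := by
  have h (x : ℤ) : x ^ 2 ≡ (a : ℤ) [ZMOD (p : ℤ)] ↔ (x : ZMod p) ^ 2 = (a : ZMod p) := by
    rw [← ZMod.intCast_eq_intCast_iff]
    push_cast
    rfl
  simp only [IsQR, h, isSquare_iff_exists_sq]
  constructor
  · rintro ⟨x, hx⟩
    exact ⟨x, hx.symm⟩
  · rintro ⟨y, hy⟩
    obtain ⟨x, rfl⟩ := ZMod.intCast_surjective y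
    exact ⟨x, hy.symm⟩

open Classical in
lemma quadDirichlet_natCast_of_mem_Icc {p : ℕ} [Fact p.Prime] {a : ℕ} (ha : a ∈ Icc 1 (p - 1)) :
    quadDirichlet p (a : ZMod p) = 1 - 2 * if ¬ IsQR p a then 1 else 0 := by
  have ha0 : (a : ZMod p) ≠ 0 := by
    rw [mem_Icc] at ha
    rw [Ne, ZMod.natCast_eq_zero_iff]
    exact fun h => by have := Nat.le_of_dvd (by omega) h; omega
  rw [quadDirichlet_apply, isQR_iff_isSquare]
  by_cases h : IsSquare (a : ZMod p)
  · rw [(quadraticChar_one_iff_isSquare ha0).2 h]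
    simp [h]
  · rw [quadraticChar_neg_one_iff_not_isSquare.2 h]
    simp [h]
    norm_num

lemma classSumThree_quadDirichlet_zero (p : ℕ) [Fact p.Prime] :
    classSumThree (quadDirichlet p) 0 = ((p - 1) / 3 : ℕ) - 2 * (Ncount p 3 : ℂ) := by
  classical
  have hcard : #{a ∈ Icc 1 (p - 1) | a % 3 = 0} = (p - 1) / 3 := by
    rw [← Nat.Ioc_filter_dvd_card_eq_div]
    congr 1
    ext a
    simp only [mem_filter, mem_Icc, mem_Ioc]
    omega
  have hN : Ncount p 3 = #{a ∈ Icc 1 (p - 1) | a % 3 = 0 ∧ ¬ IsQR p a} := by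
    rw [Ncount]
    congr 1
    ext a
    simp only [mem_filter, Nat.dvd_iff_mod_eq_zero]
  rw [classSumThree, sum_congr rfl fun a ha =>
    quadDirichlet_natCast_of_mem_Icc (mem_filter.1 ha).1, sum_sub_distrib, ← mul_sum, sum_boole,
    filter_filter, ← hN, sum_const, hcard]
  simp

end

theorem stmt7 (ε : ℝ) (hε0 : 0 < ε) (hε : ε < 1 / 2) :
    ∃ C : ℝ, 0 < C ∧ ∀ p : ℕ, p.Prime → (p % 12 = 1 ∨ p % 12 = 11) →
      ((p : ℝ) - 1) / 6 - (Ncount p 3 : ℝ) ≥ C * (p : ℝ) ^ ((1 : ℝ) / 2 - ε) := by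
  obtain ⟨C, hC, h⟩ := exists_le_classSumThree hε0
  refine ⟨C / 2, by positivity, fun p hp hmod => ?_⟩
  have : Fact p.Prime := ⟨hp⟩
  have h1 := h p hmod
  have h2 : (classSumThree (quadDirichlet p) 0).re = ((p - 1) / 3 : ℕ) - 2 * (Ncount p 3 : ℝ) := by
    rw [classSumThree_quadDirichlet_zero]
    simp
  have h3 : (((p - 1) / 3 : ℕ) : ℝ) ≤ ((p : ℝ) - 1) / 3 := by
    have := Nat.cast_div_le (α := ℝ) (m := p - 1) (n := 3)
    rwa [Nat.cast_sub hp.one_le, Nat.cast_one, Nat.cast_ofNat] at this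
  rw [h2] at h1
  linarith
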